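/- Let P be an irreducible reversible Markov transition matrix on a finite state space V with stationary distribution π, run in continuous time at rate 1, and let ∅ ≠ A ⊊ V be such that P_a(T_b < T_A) > 0 for all a, b ∈ A^c. Let α be the quasi-stationary distribution of A, let t_rel be the relaxation time of the chain, and write ‖α/π‖₂² = Σ_x α(x)²/π(x). Then for all t ≥ 0: 0 ≤ P_π(T_A > t) − (1/‖α/π‖₂²)·exp(−t/E_α(T_A)) ≤ ((‖α/π‖₂² − 1)/‖α/π‖₂² − π(A))·exp(−t/t_rel). Consequently, 0 ≤ E_π(T_A) − (1/‖α/π‖₂²)·E_α(T_A) ≤ ((‖α/π‖₂² − 1)/‖α/π‖₂² − π(A))·t_rel, and 0 ≤ E_α(T_A) − E_π(T_A) ≤ ((‖α/π‖₂² − 1)/‖α/π‖₂²)·E_α(T_A). -/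

import Mathlib

open MeasureTheory Filter

noncomputable section

/-- Heat kernel (transition semigroup) of the continuous-time rate-1 Markov chain with
one-step transition matrix `K`, given by the uniformization formula
`p_t = e^{-t} ∑_k (t^k/k!) K^k`. -/
def heatKer {V : Type} [Fintype V] [DecidableEq V] (K : Matrix V V ℝ) (t : ℝ) (x y : V) : ℝ :=
  ∑' k : ℕ, Real.exp (-t) * t ^ k / (Nat.factorial k : ℝ) * (K ^ k) x y

/-- A continuous-time Markov chain with jump matrix `K`: a family of path measures `P x`
(for the chain started at `x`), with right-continuous paths, whose finite-dimensional
distributions are given by the heat kernel of `K`. -/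
structure CTMC (V : Type) [Fintype V] [DecidableEq V] (K : Matrix V V ℝ) where
  Ω : Type
  mΩ : MeasurableSpace Ω
  P : V → @Measure Ω mΩ
  prob : ∀ x, IsProbabilityMeasure (P x)
  X : ℝ → Ω → V
  measX : ∀ (t : ℝ) (y : V), MeasurableSet[mΩ] {ω | X t ω = y}
  rightCts : ∀ (ω : Ω) (t : ℝ), ∃ ε > 0, ∀ s, t ≤ s → s < t + ε → X s ω = X t ω
  fdd : ∀ (x : V) (n : ℕ) (t : Fin (n + 1) → ℝ), Monotone t → t 0 = 0 →
    ∀ y : Fin (n + 1) → V,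
      P x {ω | ∀ i, X (t i) ω = y i} =
        ENNReal.ofReal ((if y 0 = x then (1 : ℝ) else 0) *
          ∏ i : Fin n, heatKer K (t i.succ - t i.castSucc) (y i.castSucc) (y i.succ))

namespace CTMC

variable {V : Type} [Fintype V] [DecidableEq V] {K : Matrix V V ℝ}

/-- Hitting time of a set of states. -/
def hit (W : CTMC V K) (A : Set V) (ω : W.Ω) : ℝ :=
  sInf {t : ℝ | 0 ≤ t ∧ W.X t ω ∈ A}

/-- Cover time: the first time every state has been visited. -/
def cov (W : CTMC V K) (ω : W.Ω) : ℝ :=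
  sInf {t : ℝ | 0 ≤ t ∧ ∀ y : V, ∃ s, 0 ≤ s ∧ s ≤ t ∧ W.X s ω = y}

/-- The uncovered set at time `t`. -/
def uncov (W : CTMC V K) (t : ℝ) (ω : W.Ω) : Set V :=
  {y | ∀ s, 0 ≤ s → s ≤ t → W.X s ω ≠ y}

/-- Local time at `y` up to time `t`. -/
def loc (W : CTMC V K) (y : V) (t : ℝ) (ω : W.Ω) : ℝ :=
  ∫ s in (0:ℝ)..t, (if W.X s ω = y then (1 : ℝ) else 0)

/-- Probability of an event for the walk started at `x`. -/
def prx (W : CTMC V K) (x : V) (S : Set W.Ω) : ℝ := (W.P x S).toReal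

/-- Expectation of a path functional for the walk started at `x`. -/
def ex (W : CTMC V K) (x : V) (f : W.Ω → ℝ) : ℝ := ∫ ω, f ω ∂(W.P x)

/-- Probability of an event for the walk started from the uniform (stationary) distribution. -/
def prpi (W : CTMC V K) (S : Set W.Ω) : ℝ :=
  (Fintype.card V : ℝ)⁻¹ * ∑ x : V, W.prx x S

/-- Expectation for the walk started from the uniform (stationary) distribution. -/
def epi (W : CTMC V K) (f : W.Ω → ℝ) : ℝ :=
  (Fintype.card V : ℝ)⁻¹ * ∑ x : V, W.ex x f

/-- Probability for the walk started from the initial distribution `a`. -/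
def prw (W : CTMC V K) (a : V → ℝ) (S : Set W.Ω) : ℝ := ∑ x : V, a x * W.prx x S

/-- Expectation for the walk started from the initial distribution `a`. -/
def exw (W : CTMC V K) (a : V → ℝ) (f : W.Ω → ℝ) : ℝ := ∑ x : V, a x * W.ex x f

end CTMC

/-- Total variation mixing time at level `1/4`. -/
def tmixTV {V : Type} [Fintype V] [DecidableEq V] (K : Matrix V V ℝ) : ℝ :=
  sInf {t : ℝ | 0 ≤ t ∧ ∀ x : V, ∑ y : V, |heatKer K t x y - (Fintype.card V : ℝ)⁻¹| ≤ 1 / 2}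

/-- Transition matrix of the simple random walk on a graph. -/
def transMat {V : Type} [Fintype V] [DecidableEq V] (G : SimpleGraph V) [DecidableRel G.Adj] :
    Matrix V V ℝ :=
  Matrix.of fun x y => if G.Adj x y then ((G.degree x : ℝ))⁻¹ else 0

/-- Diameter of a finite graph. -/
def gDiam {V : Type} [Fintype V] (G : SimpleGraph V) : ℕ :=
  Finset.univ.sup fun p : V × V => G.dist p.1 p.2

/-- Vertex-transitivity of a graph. -/
def IsVertexTransitive {V : Type} (G : SimpleGraph V) : Prop :=
  ∀ x y : V, ∃ φ : SimpleGraph.Iso G G, φ x = y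

/-- A finite graph bundled together with a continuous-time rate-1 simple random walk on it. -/
structure GW where
  (V : Type) [fin : Fintype V] [deq : DecidableEq V]
  (G : SimpleGraph V) [adj : DecidableRel G.Adj]
  (W : CTMC V (transMat G))

instance (B : GW) : Fintype B.V := B.fin
instance (B : GW) : DecidableEq B.V := B.deq
instance (B : GW) : DecidableRel B.G.Adj := B.adj
instance (B : GW) : MeasurableSpace B.W.Ω := B.W.mΩ

/-- Number of vertices. -/
def GW.nV (B : GW) : ℕ := Fintype.card B.V

/-- Diameter. -/
def GW.D (B : GW) : ℕ := gDiam B.G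

/-- `f(n)`, defined by `n = D² f(n)`. -/
def GW.fgrowth (B : GW) : ℝ := (B.nV : ℝ) / (B.D : ℝ) ^ 2

/-- Standing assumptions: a sequence of finite connected vertex-transitive graphs with
degrees uniformly bounded by `d`, of diverging sizes, satisfying the diameter condition
`D² = o(n / log n)`. -/
def GoodSeq (B : ℕ → GW) (d : ℕ) : Prop :=
  (∀ n, (B n).G.Connected) ∧
  (∀ n, IsVertexTransitive (B n).G) ∧
  (∀ n (x : (B n).V), (B n).G.degree x ≤ d) ∧
  Tendsto (fun n => (B n).nV) atTop atTop ∧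
  Tendsto (fun n => ((B n).D : ℝ) ^ 2 * Real.log ((B n).nV) / ((B n).nV)) atTop (nhds 0)

/-- The transition matrix of the chain killed upon hitting `A`. -/
def killedMat {V : Type} [Fintype V] [DecidableEq V] (K : Matrix V V ℝ) (A : Finset V) :
    Matrix V V ℝ :=
  Matrix.of fun x y => if x ∈ A ∨ y ∈ A then 0 else K x y

/-- `a` is the quasi-stationary distribution of `A` with rate `lam`: a probability
distribution supported off `A` which is a left eigenvector of the killed matrix for the
eigenvalue `1 - lam`, where `lam` is the smallest eigenvalue of `I_B - P_B`. -/
structure IsQSD {V : Type} [Fintype V] [DecidableEq V] (K : Matrix V V ℝ) (A : Finset V)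
    (a : V → ℝ) (lam : ℝ) : Prop where
  nonneg : ∀ x, 0 ≤ a x
  sum_one : ∑ x : V, a x = 1
  supported : ∀ v ∈ A, a v = 0
  eigen : ∀ y : V, ∑ x : V, a x * killedMat K A x y = (1 - lam) * a y
  minimal : ∀ (mu : ℝ) (g : V → ℝ), g ≠ 0 → (∀ v ∈ A, g v = 0) →
    (∀ y : V, ∑ x : V, g x * killedMat K A x y = (1 - mu) * g y) → lam ≤ mu

/-- Spectral gap `1 - λ₂` of a reversible transition matrix `K` with stationary
distribution `pd`. -/
def specGap {V : Type} [Fintype V] (K : Matrix V V ℝ) (pd : V → ℝ) : ℝ :=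
  sInf {r : ℝ | ∃ g : V → ℝ, g ≠ 0 ∧ (∑ x : V, pd x * g x = 0) ∧
    ∀ y : V, ∑ x : V, K y x * g x = (1 - r) * g y}

/-- Relaxation time of a reversible chain. -/
def trel {V : Type} [Fintype V] (K : Matrix V V ℝ) (pd : V → ℝ) : ℝ := (specGap K pd)⁻¹

/-- Total variation distance between two Borel measures on `ℝ`. -/
def dTVReal (μ ν : Measure ℝ) : ℝ :=
  ⨆ A : {A : Set ℝ // MeasurableSet A}, |(μ A.1).toReal - (ν A.1).toReal|

/-- The standard Gumbel distribution on `ℝ` (distribution function `s ↦ exp (-e^{-s})`). -/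
def gumbelMeasure : Measure ℝ :=
  volume.withDensity fun s => ENNReal.ofReal (Real.exp (-s - Real.exp (-s)))

/-- `ψ(u) = (2/π²) ∑_{k ≥ 1} cos(2πku)/k²`. -/
def psiSeries (u : ℝ) : ℝ :=
  (2 / Real.pi ^ 2) * ∑' k : ℕ, Real.cos (2 * Real.pi * ((k : ℝ) + 1) * u) / ((k : ℝ) + 1) ^ 2

/-- The cycle graph on `ℤ/mℤ`. -/
def cycleG (m : ℕ) : SimpleGraph (ZMod m) := SimpleGraph.fromRel fun x y => x - y = 1

instance (m : ℕ) : DecidableRel (cycleG m).Adj := fun _ _ => Classical.dec _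

section HeatKernel

set_option linter.unusedSectionVars false

open scoped Matrix.Norms.Operator

variable {V : Type} [Fintype V] [DecidableEq V]

/-- The heat kernel as a matrix. -/
def heatMat (K : Matrix V V ℝ) (t : ℝ) : Matrix V V ℝ := Matrix.of (heatKer K t)

/-- The Poisson weights appearing in the uniformization formula. -/
def poissonWeight (t : ℝ) (k : ℕ) : ℝ := Real.exp (-t) * t ^ k / (Nat.factorial k : ℝ)

lemma poissonWeight_nonneg {t : ℝ} (ht : 0 ≤ t) (k : ℕ) : 0 ≤ poissonWeight t k := by
  unfold poissonWeight; positivity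

lemma hasSum_poissonWeight_mul_pow (t m : ℝ) :
    HasSum (fun k => poissonWeight t k * m ^ k) (Real.exp (-((1 - m) * t))) := by
  have h := (NormedSpace.expSeries_div_hasSum_exp (t * m)).mul_left (Real.exp (-t))
  rw [← congrFun Real.exp_eq_exp_ℝ, ← Real.exp_add] at h
  have e1 : (fun k => poissonWeight t k * m ^ k) =
      fun k : ℕ => Real.exp (-t) * ((t * m) ^ k / (k.factorial : ℝ)) := by
    ext k; unfold poissonWeight; rw [mul_pow]; ring
  have e2 : -((1 - m) * t) = -t + t * m := by ring
  rw [e1, e2]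
  exact h

lemma hasSum_poissonWeight (t : ℝ) : HasSum (poissonWeight t) 1 := by
  simpa using hasSum_poissonWeight_mul_pow t 1

lemma heatMat_hasSum (K : Matrix V V ℝ) (t : ℝ) :
    HasSum (fun k => poissonWeight t k • K ^ k) (Real.exp (-t) • NormedSpace.exp (t • K)) := by
  have h := (NormedSpace.exp_series_hasSum_exp' (𝕂 := ℝ) (t • K)).const_smul (Real.exp (-t))
  have e : (fun k => poissonWeight t k • K ^ k) =
      fun k : ℕ => Real.exp (-t) • (k.factorial : ℝ)⁻¹ • (t • K) ^ k := by
    ext1 k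
    rw [smul_pow, smul_smul, smul_smul]
    congr 1
    unfold poissonWeight
    ring
  rw [e]
  exact h

lemma hasSum_matrix_apply {f : ℕ → Matrix V V ℝ} {M : Matrix V V ℝ} (h : HasSum f M) (x y : V) :
    HasSum (fun k => f k x y) (M x y) :=
  Pi.hasSum.1 (Pi.hasSum.1 h x) y

lemma heatMat_eq_smul_exp (K : Matrix V V ℝ) (t : ℝ) :
    heatMat K t = Real.exp (-t) • NormedSpace.exp (t • K) := by
  ext x y
  exact (hasSum_matrix_apply (heatMat_hasSum K t) x y).tsum_eq

lemma hasSum_heatMat_apply (K : Matrix V V ℝ) (t : ℝ) (x y : V) :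
    HasSum (fun k => poissonWeight t k * (K ^ k) x y) (heatMat K t x y) := by
  rw [heatMat_eq_smul_exp]
  exact hasSum_matrix_apply (heatMat_hasSum K t) x y

lemma hasSum_heatMat_mulVec (K : Matrix V V ℝ) (t : ℝ) (v : V → ℝ) (x : V) :
    HasSum (fun k => poissonWeight t k * ((K ^ k).mulVec v) x) ((heatMat K t).mulVec v x) := by
  have h := hasSum_sum (s := Finset.univ)
    (fun y _ => (hasSum_heatMat_apply K t x y).mul_right (v y))
  have e : (fun k => poissonWeight t k * ((K ^ k).mulVec v) x) =
      fun k => ∑ y, poissonWeight t k * (K ^ k) x y * v y := by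
    ext k
    simp [Matrix.mulVec, dotProduct, Finset.mul_sum, mul_assoc]
  rw [e]
  exact h

lemma heatMat_eq_exp (K : Matrix V V ℝ) (t : ℝ) :
    heatMat K t = NormedSpace.exp (t • (K - 1)) := by
  have h1 : t • (K - 1) = algebraMap ℝ (Matrix V V ℝ) (-t) + t • K := by
    rw [Algebra.algebraMap_eq_smul_one, smul_sub, neg_smul]; abel
  have h2 : algebraMap ℝ (Matrix V V ℝ) (Real.exp (-t)) =
      NormedSpace.exp (algebraMap ℝ (Matrix V V ℝ) (-t)) := by
    rw [Real.exp_eq_exp_ℝ]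
    exact NormedSpace.algebraMap_exp_comm (-t)
  rw [heatMat_eq_smul_exp, h1,
    Matrix.exp_add_of_commute _ _ (Algebra.commute_algebraMap_left (-t) (t • K)),
    ← h2, Algebra.smul_def]

lemma heatMat_zero (K : Matrix V V ℝ) : heatMat K 0 = 1 := by
  rw [heatMat_eq_exp, zero_smul, NormedSpace.exp_zero]

lemma heatMat_add (K : Matrix V V ℝ) (s t : ℝ) :
    heatMat K (s + t) = heatMat K s * heatMat K t := by
  simp only [heatMat_eq_exp, add_smul]
  exact Matrix.exp_add_of_commute _ _ (((Commute.refl (K - 1)).smul_left s).smul_right t)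

lemma heatMat_nat_mul (K : Matrix V V ℝ) (m : ℕ) (h : ℝ) :
    heatMat K (m * h) = heatMat K h ^ m := by
  induction m with
  | zero => simp [heatMat_zero]
  | succ m ih => rw [pow_succ, ← ih, ← heatMat_add]; congr 1; push_cast; ring

lemma hasDerivAt_heatMat (K : Matrix V V ℝ) (t : ℝ) :
    HasDerivAt (heatMat K) ((K - 1) * heatMat K t) t := by
  have h := hasDerivAt_exp_smul_const' (𝕂 := ℝ) (K - 1) t
  rw [funext (heatMat_eq_exp K)]
  exact h

lemma hasDerivAt_heatMat_mulVec (K : Matrix V V ℝ) (v : V → ℝ) (t : ℝ) (x : V) :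
    HasDerivAt (fun t => (heatMat K t).mulVec v x)
      (K.mulVec ((heatMat K t).mulVec v) x - (heatMat K t).mulVec v x) t := by
  have h1 : ∀ y, HasDerivAt (fun t => heatMat K t x y) (((K - 1) * heatMat K t) x y) t :=
    fun y => hasDerivAt_pi.1 (hasDerivAt_pi.1 (hasDerivAt_heatMat K t) x) y
  have h2 := HasDerivAt.fun_sum (u := Finset.univ) (fun y _ => (h1 y).mul_const (v y))
  have e : K.mulVec ((heatMat K t).mulVec v) x - (heatMat K t).mulVec v x =
      (((K - 1) * heatMat K t).mulVec v) x := by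
    rw [← Matrix.mulVec_mulVec, Matrix.sub_mulVec, Matrix.one_mulVec]
    rfl
  rw [e]
  exact h2

lemma continuous_heatMat_mulVec (K : Matrix V V ℝ) (v : V → ℝ) (x : V) :
    Continuous (fun t => (heatMat K t).mulVec v x) :=
  continuous_iff_continuousAt.2 fun t => (hasDerivAt_heatMat_mulVec K v t x).continuousAt

lemma pow_mulVec_eigen {K : Matrix V V ℝ} {f : V → ℝ} {m : ℝ} (hf : K.mulVec f = m • f) (k : ℕ) :
    (K ^ k).mulVec f = m ^ k • f := by
  induction k with
  | zero => simp
  | succ k ih =>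
    rw [pow_succ, ← Matrix.mulVec_mulVec, hf, Matrix.mulVec_smul, ih, smul_smul, pow_succ,
      mul_comm]

lemma heatMat_mulVec_eigen {K : Matrix V V ℝ} {f : V → ℝ} {m : ℝ} (hf : K.mulVec f = m • f)
    (t : ℝ) : (heatMat K t).mulVec f = Real.exp (-((1 - m) * t)) • f := by
  ext x
  refine (hasSum_heatMat_mulVec K t f x).unique ?_
  have h := (hasSum_poissonWeight_mul_pow t m).mul_right (f x)
  have e : (fun k => poissonWeight t k * ((K ^ k).mulVec f) x) =
      fun k => poissonWeight t k * m ^ k * f x := by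
    ext k
    simp [pow_mulVec_eigen hf, mul_assoc]
  rw [e]
  exact h

/-- A nonnegative matrix with row sums at most one. -/
structure IsSubstochastic (K : Matrix V V ℝ) : Prop where
  nonneg : ∀ x y, 0 ≤ K x y
  sum_le : ∀ x, ∑ y, K x y ≤ 1

namespace IsSubstochastic

variable {K L : Matrix V V ℝ}

lemma one : IsSubstochastic (1 : Matrix V V ℝ) where
  nonneg x y := by rw [Matrix.one_apply]; split_ifs <;> norm_num
  sum_le x := by simp [Matrix.one_apply]

lemma mul (hK : IsSubstochastic K) (hL : IsSubstochastic L) : IsSubstochastic (K * L) where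
  nonneg x y := Finset.sum_nonneg fun z _ => mul_nonneg (hK.nonneg x z) (hL.nonneg z y)
  sum_le x := by
    simp only [Matrix.mul_apply]
    rw [Finset.sum_comm]
    calc ∑ z, ∑ y, K x z * L z y = ∑ z, K x z * ∑ y, L z y := by simp [Finset.mul_sum]
      _ ≤ ∑ z, K x z * 1 :=
        Finset.sum_le_sum fun z _ => mul_le_mul_of_nonneg_left (hL.sum_le z) (hK.nonneg x z)
      _ ≤ 1 := by simpa using hK.sum_le x

lemma pow (hK : IsSubstochastic K) (k : ℕ) : IsSubstochastic (K ^ k) := by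
  induction k with
  | zero => simpa using one
  | succ k ih => rw [pow_succ]; exact ih.mul hK

lemma apply_le_one (hK : IsSubstochastic K) (x y : V) : K x y ≤ 1 :=
  (Finset.single_le_sum (f := K x) (fun z _ => hK.nonneg x z) (Finset.mem_univ y)).trans
    (hK.sum_le x)

lemma heat (hK : IsSubstochastic K) {t : ℝ} (ht : 0 ≤ t) : IsSubstochastic (heatMat K t) where
  nonneg x y := (hasSum_heatMat_apply K t x y).nonneg fun k =>
    mul_nonneg (poissonWeight_nonneg ht k) ((hK.pow k).nonneg x y)
  sum_le x := by
    have h := hasSum_sum (s := Finset.univ) (fun y _ => hasSum_heatMat_apply K t x y)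
    refine hasSum_le (fun k => ?_) h (hasSum_poissonWeight t)
    rw [← Finset.mul_sum]
    exact mul_le_of_le_one_right (poissonWeight_nonneg ht k) ((hK.pow k).sum_le x)

lemma abs_mulVec_le (hK : IsSubstochastic K) {v : V → ℝ} {c : ℝ} (hv : ∀ x, |v x| ≤ c) (hc : 0 ≤ c)
    (x : V) : |K.mulVec v x| ≤ c := by
  calc |K.mulVec v x| ≤ ∑ y, |K x y * v y| := Finset.abs_sum_le_sum_abs _ _
    _ ≤ ∑ y, K x y * c := Finset.sum_le_sum fun y _ => by
        rw [abs_mul, abs_of_nonneg (hK.nonneg x y)]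
        exact mul_le_mul_of_nonneg_left (hv y) (hK.nonneg x y)
    _ = (∑ y, K x y) * c := (Finset.sum_mul _ _ _).symm
    _ ≤ c := mul_le_of_le_one_left hc (hK.sum_le x)

/-- Heat kernels of two substochastic matrices agree to second order at entries where the matrices
agree. -/
lemma abs_heatMat_sub_le (hK : IsSubstochastic K) (hL : IsSubstochastic L) {x y : V}
    (hxy : K x y = L x y) {t : ℝ} (ht : 0 ≤ t) :
    |heatMat K t x y - heatMat L t x y| ≤ t ^ 2 := by
  have h := (hasSum_heatMat_apply K t x y).sub (hasSum_heatMat_apply L t x y)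
  have h' := (hasSum_nat_add_iff' 2).2 h
  have hw := (hasSum_nat_add_iff' 2).2 (hasSum_poissonWeight t)
  simp only [Finset.sum_range_succ, Finset.sum_range_zero, pow_zero, pow_one, hxy, sub_self,
    zero_add, sub_zero, add_zero] at h' hw
  have hle : |heatMat K t x y - heatMat L t x y| ≤
      1 - (poissonWeight t 0 + poissonWeight t 1) := by
    rw [abs_le]
    constructor
    · refine hasSum_le (fun k => ?_) hw.neg h'
      have := mul_le_mul_of_nonneg_left ((hL.pow (k + 2)).apply_le_one x y)
        (poissonWeight_nonneg ht (k + 2))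
      have := mul_nonneg (poissonWeight_nonneg ht (k + 2)) ((hK.pow (k + 2)).nonneg x y)
      linarith
    · refine hasSum_le (fun k => ?_) h' hw
      have := mul_le_mul_of_nonneg_left ((hK.pow (k + 2)).apply_le_one x y)
        (poissonWeight_nonneg ht (k + 2))
      have := mul_nonneg (poissonWeight_nonneg ht (k + 2)) ((hL.pow (k + 2)).nonneg x y)
      linarith
  refine hle.trans ?_
  have he : 1 - t ≤ Real.exp (-t) := by linarith [Real.add_one_le_exp (-t)]
  simp only [poissonWeight, pow_zero, pow_one, Nat.factorial_zero, Nat.factorial_one, Nat.cast_one]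
  nlinarith

end IsSubstochastic

end HeatKernel

section Reversible

set_option linter.unusedSectionVars false

variable {V : Type} [Fintype V] [DecidableEq V]

/-- The inner product with weights `pd`. -/
def wInner (pd u v : V → ℝ) : ℝ := ∑ x, pd x * u x * v x

lemma wInner_comm (pd u v : V → ℝ) : wInner pd u v = wInner pd v u :=
  Finset.sum_congr rfl fun x _ => by ring

lemma wInner_add_left (pd u v w : V → ℝ) :
    wInner pd (u + v) w = wInner pd u w + wInner pd v w := by
  simp only [wInner, ← Finset.sum_add_distrib, Pi.add_apply]
  exact Finset.sum_congr rfl fun x _ => by ring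

lemma wInner_smul_left (pd u w : V → ℝ) (c : ℝ) :
    wInner pd (c • u) w = c * wInner pd u w := by
  simp only [wInner, Finset.mul_sum, Pi.smul_apply, smul_eq_mul]
  exact Finset.sum_congr rfl fun x _ => by ring

lemma wInner_add_right (pd u v w : V → ℝ) :
    wInner pd w (u + v) = wInner pd w u + wInner pd w v := by
  simp only [wInner_comm pd w, wInner_add_left]

lemma wInner_smul_right (pd u w : V → ℝ) (c : ℝ) :
    wInner pd w (c • u) = c * wInner pd w u := by
  simp only [wInner_comm pd w, wInner_smul_left]

lemma wInner_sub_left (pd u v w : V → ℝ) :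
    wInner pd (u - v) w = wInner pd u w - wInner pd v w := by
  simp only [wInner, ← Finset.sum_sub_distrib, Pi.sub_apply]
  exact Finset.sum_congr rfl fun x _ => by ring

lemma wInner_sub_right (pd u v w : V → ℝ) :
    wInner pd w (u - v) = wInner pd w u - wInner pd w v := by
  simp only [wInner_comm pd w, wInner_sub_left]

lemma wInner_self_nonneg {pd : V → ℝ} (hpd : ∀ x, 0 < pd x) (u : V → ℝ) : 0 ≤ wInner pd u u :=
  Finset.sum_nonneg fun x _ => by
    rw [mul_assoc]; exact mul_nonneg (hpd x).le (mul_self_nonneg _)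

lemma wInner_self_eq_zero {pd : V → ℝ} (hpd : ∀ x, 0 < pd x) {u : V → ℝ}
    (h : wInner pd u u = 0) : u = 0 := by
  ext x
  have h1 := (Finset.sum_eq_zero_iff_of_nonneg (fun x _ => by
    rw [mul_assoc]; exact mul_nonneg (hpd x).le (mul_self_nonneg (u x)))).1 h x (Finset.mem_univ x)
  simpa [(hpd x).ne'] using h1

/-- Detailed balance of `K` with respect to `pd`. -/
def IsRev (pd : V → ℝ) (K : Matrix V V ℝ) : Prop := ∀ x y, pd x * K x y = pd y * K y x

lemma IsRev.wInner_mulVec {pd : V → ℝ} {K : Matrix V V ℝ} (h : IsRev pd K) (u v : V → ℝ) :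
    wInner pd u (K.mulVec v) = wInner pd (K.mulVec u) v := by
  simp only [wInner, Matrix.mulVec, dotProduct, Finset.mul_sum, Finset.sum_mul]
  rw [Finset.sum_comm]
  refine Finset.sum_congr rfl fun y _ => Finset.sum_congr rfl fun x _ => ?_
  linear_combination u x * v y * h x y

lemma IsRev.pow {pd : V → ℝ} {K : Matrix V V ℝ} (h : IsRev pd K) (k : ℕ) : IsRev pd (K ^ k) := by
  induction k with
  | zero =>
    intro x y
    by_cases hxy : x = y
    · subst hxy; rfl
    · simp [hxy, Ne.symm hxy]
  | succ k ih =>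
    intro x y
    rw [pow_succ, Matrix.mul_apply, ← pow_succ, pow_succ', Matrix.mul_apply, Finset.mul_sum,
      Finset.mul_sum]
    refine Finset.sum_congr rfl fun z _ => ?_
    linear_combination K z y * ih x z + (K ^ k) z x * h z y

lemma IsRev.heat {pd : V → ℝ} {K : Matrix V V ℝ} (h : IsRev pd K) (t : ℝ) :
    IsRev pd (heatMat K t) := by
  intro x y
  refine ((hasSum_heatMat_apply K t x y).mul_left (pd x)).unique ?_
  have h2 := (hasSum_heatMat_apply K t y x).mul_left (pd y)
  convert h2 using 2 with k
  linear_combination poissonWeight t k * h.pow k x y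

/-- The quadratic form of `I - K`. -/
def energy (pd : V → ℝ) (K : Matrix V V ℝ) (u : V → ℝ) : ℝ := wInner pd u (u - K.mulVec u)

lemma energy_eigen (pd : V → ℝ) {K : Matrix V V ℝ} {u : V → ℝ} {r : ℝ}
    (h : K.mulVec u = (1 - r) • u) : energy pd K u = r * wInner pd u u := by
  rw [energy, h, wInner_sub_right, wInner_smul_right]; ring

lemma energy_smul (pd : V → ℝ) (K : Matrix V V ℝ) (u : V → ℝ) (c : ℝ) :
    energy pd K (c • u) = c ^ 2 * energy pd K u := by
  rw [energy, Matrix.mulVec_smul, ← smul_sub, wInner_smul_left, wInner_smul_right, energy]; ring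

lemma IsRev.energy_add_smul {pd : V → ℝ} {K : Matrix V V ℝ} (h : IsRev pd K) (u v : V → ℝ)
    (c : ℝ) : energy pd K (u + c • v) =
      energy pd K u + 2 * c * wInner pd v (u - K.mulVec u) + c ^ 2 * energy pd K v := by
  have h1 := h.wInner_mulVec u v
  rw [wInner_comm pd (K.mulVec u) v] at h1
  simp only [energy, Matrix.mulVec_add, Matrix.mulVec_smul, wInner_add_left, wInner_add_right,
    wInner_sub_right, wInner_smul_left, wInner_smul_right, h1, wInner_comm pd u v]
  ring

lemma continuous_wInner_self (pd : V → ℝ) : Continuous fun u : V → ℝ => wInner pd u u := by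
  unfold wInner; fun_prop

lemma continuous_energy (pd : V → ℝ) (K : Matrix V V ℝ) : Continuous (energy pd K) := by
  unfold energy wInner Matrix.mulVec dotProduct
  simp only [Pi.sub_apply]
  fun_prop

lemma isCompact_sphere_inter {pd : V → ℝ} (hpd : ∀ x, 0 < pd x) (U : Submodule ℝ (V → ℝ)) :
    IsCompact {u : V → ℝ | u ∈ U ∧ wInner pd u u = 1} := by
  have hclosed : IsClosed {u : V → ℝ | u ∈ U ∧ wInner pd u u = 1} :=
    (Submodule.closed_of_finiteDimensional U).inter
      (isClosed_eq (continuous_wInner_self pd) continuous_const)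
  refine (isCompact_univ_pi fun x => isCompact_Icc
    (a := -(1 + (pd x)⁻¹)) (b := 1 + (pd x)⁻¹)).of_isClosed_subset hclosed ?_
  rintro u ⟨-, hu⟩ x -
  have h1 : pd x * u x * u x ≤ 1 := by
    rw [← hu]
    exact Finset.single_le_sum (f := fun x => pd x * u x * u x) (fun y _ => by
      rw [mul_assoc]; exact mul_nonneg (hpd y).le (mul_self_nonneg (u y))) (Finset.mem_univ x)
  have h2 : u x * u x ≤ (pd x)⁻¹ := by
    rw [← one_div, le_div_iff₀ (hpd x)]; linarith
  have h3 : 0 < (pd x)⁻¹ := inv_pos.2 (hpd x)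
  constructor <;> nlinarith

lemma eq_zero_of_quadratic_nonneg {b c : ℝ} (h : ∀ e : ℝ, 0 ≤ 2 * e * b + e ^ 2 * c) : b = 0 := by
  by_contra hb
  have hb2 : 0 < b ^ 2 := by positivity
  have hc : 0 < 1 + |c| := by positivity
  have h1 := h (-b / (1 + |c|))
  have h2 : 2 * (-b / (1 + |c|)) * b + (-b / (1 + |c|)) ^ 2 * c =
      b ^ 2 / (1 + |c|) ^ 2 * (c - 2 * (1 + |c|)) := by
    field_simp; ring
  rw [h2] at h1
  have h3 : 0 < b ^ 2 / (1 + |c|) ^ 2 := by positivity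
  have h4 : c - 2 * (1 + |c|) < 0 := by linarith [le_abs_self c, abs_nonneg c]
  nlinarith

/-- On an invariant subspace, the minimum of the Rayleigh quotient is attained at an
eigenvector. -/
lemma IsRev.exists_rayleigh_min {pd : V → ℝ} (hpd : ∀ x, 0 < pd x) {K : Matrix V V ℝ}
    (hK : IsRev pd K) {U : Submodule ℝ (V → ℝ)} (hU : U ≠ ⊥) (hinv : ∀ u ∈ U, K.mulVec u ∈ U) :
    ∃ (r : ℝ) (g : V → ℝ), g ∈ U ∧ g ≠ 0 ∧ K.mulVec g = (1 - r) • g ∧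
      ∀ u ∈ U, r * wInner pd u u ≤ energy pd K u := by
  have hnorm : ∀ u ∈ U, u ≠ 0 → 0 < wInner pd u u ∧
      (Real.sqrt (wInner pd u u))⁻¹ • u ∈ {u : V → ℝ | u ∈ U ∧ wInner pd u u = 1} := by
    intro u hu hu0
    have h1 : 0 < wInner pd u u :=
      (wInner_self_nonneg hpd u).lt_of_ne fun h => hu0 (wInner_self_eq_zero hpd h.symm)
    refine ⟨h1, U.smul_mem _ hu, ?_⟩
    rw [wInner_smul_left, wInner_smul_right]
    have h2 := Real.sq_sqrt h1.le
    have h3 := Real.sqrt_pos.2 h1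
    field_simp
    linarith
  obtain ⟨u0, hu0, hu0'⟩ := U.ne_bot_iff.1 hU
  obtain ⟨g, ⟨hgU, hg1⟩, hmin⟩ := (isCompact_sphere_inter hpd U).exists_isMinOn
    ⟨_, (hnorm u0 hu0 hu0').2⟩ (continuous_energy pd K).continuousOn
  have hray : ∀ u ∈ U, energy pd K g * wInner pd u u ≤ energy pd K u := by
    intro u hu
    by_cases hu0 : u = 0
    · subst hu0; simp [energy, wInner]
    · obtain ⟨h1, h2⟩ := hnorm u hu hu0
      have h3 := isMinOn_iff.1 hmin _ h2
      rwa [energy_smul, inv_pow, Real.sq_sqrt h1.le, inv_mul_eq_div, le_div_iff₀ h1] at h3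
  refine ⟨energy pd K g, g, hgU, ?_, ?_, hray⟩
  · rintro rfl; simp [wInner] at hg1
  · set r := energy pd K g with hr
    set v : V → ℝ := (g - K.mulVec g) - r • g with hv
    have hvU : v ∈ U := U.sub_mem (U.sub_mem hgU (hinv g hgU)) (U.smul_mem _ hgU)
    have hb : wInner pd v v = 0 := by
      refine eq_zero_of_quadratic_nonneg (c := energy pd K v - r * wInner pd v v) fun e => ?_
      have h1 := hray (g + e • v) (U.add_mem hgU (U.smul_mem _ hvU))
      rw [hK.energy_add_smul] at h1
      have h2 : wInner pd (g + e • v) (g + e • v) =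
          wInner pd g g + 2 * e * wInner pd v g + e ^ 2 * wInner pd v v := by
        simp only [wInner_add_left, wInner_add_right, wInner_smul_left, wInner_smul_right,
          wInner_comm pd g v]
        ring
      have h3 : wInner pd v v = wInner pd v (g - K.mulVec g) - r * wInner pd v g := by
        rw [← wInner_smul_right, ← wInner_sub_right]
      rw [h2, hg1, ← hr] at h1
      linear_combination h1 - 2 * e * h3
    have hv0 := wInner_self_eq_zero hpd hb
    ext x
    have := congrFun hv0 x
    simp only [hv, Pi.sub_apply, Pi.smul_apply, smul_eq_mul, Pi.zero_apply] at this ⊢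
    linarith

/-- Exponential decay of the semigroup on a subspace where the energy controls the norm. -/
lemma IsRev.wInner_heatMat_bounds {pd : V → ℝ} (hpd : ∀ x, 0 < pd x) {K : Matrix V V ℝ}
    (hK : IsRev pd K) {g : V → ℝ} {c : ℝ}
    (hc : ∀ t, c * wInner pd ((heatMat K t).mulVec g) ((heatMat K t).mulVec g) ≤
      energy pd K ((heatMat K t).mulVec g)) {t : ℝ} (ht : 0 ≤ t) :
    0 ≤ wInner pd g ((heatMat K t).mulVec g) ∧
      wInner pd g ((heatMat K t).mulVec g) ≤ wInner pd g g * Real.exp (-(c * t)) := by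
  set u : ℝ → V → ℝ := fun t => (heatMat K t).mulVec g with hu
  have hphi : wInner pd g (u t) = wInner pd (u (t / 2)) (u (t / 2)) := by
    have h1 : u t = (heatMat K (t / 2)).mulVec (u (t / 2)) := by
      rw [hu]; simp only
      rw [Matrix.mulVec_mulVec, ← heatMat_add, add_halves]
    rw [h1, (hK.heat (t / 2)).wInner_mulVec]
  have hderiv : ∀ s, HasDerivAt (fun s => Real.exp (2 * c * s) * wInner pd (u s) (u s))
      (Real.exp (2 * c * s) * (2 * c) * wInner pd (u s) (u s) +
        Real.exp (2 * c * s) * (-2 * energy pd K (u s))) s := by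
    intro s
    have he : HasDerivAt (fun s => Real.exp (2 * c * s)) (Real.exp (2 * c * s) * (2 * c)) s := by
      simpa using ((hasDerivAt_id s).const_mul (2 * c)).exp
    refine he.mul ?_
    have h1 := fun x => hasDerivAt_heatMat_mulVec K g s x
    have h2 := HasDerivAt.fun_sum (u := Finset.univ)
      (fun x _ => ((h1 x).const_mul (pd x)).mul (h1 x))
    refine h2.congr_deriv ?_
    simp only [energy, wInner, Finset.mul_sum]
    refine Finset.sum_congr rfl fun x _ => ?_
    simp only [Pi.sub_apply, hu]
    ring
  have hanti := antitone_of_hasDerivAt_nonpos hderiv (fun s => by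
    have := mul_nonneg (Real.exp_pos (2 * c * s)).le (sub_nonneg.2 (hc s))
    simp only [Pi.zero_apply]
    nlinarith) (show (0 : ℝ) ≤ t / 2 by linarith)
  have h0 : u 0 = g := by simp [hu, heatMat_zero]
  rw [hphi]
  refine ⟨wInner_self_nonneg hpd _, ?_⟩
  simp only [h0, mul_zero, Real.exp_zero, one_mul] at hanti
  rw [Real.exp_neg, ← div_eq_mul_inv, le_div_iff₀ (Real.exp_pos _)]
  calc _ = _ := by rw [mul_comm, show c * t = 2 * c * (t / 2) by ring]
    _ ≤ _ := hanti

end Reversible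

section Killed

set_option linter.unusedSectionVars false

variable {V : Type} [Fintype V] [DecidableEq V]

/-- The indicator function of the complement of `A`. -/
def indCompl (A : Finset V) : V → ℝ := fun x => if x ∈ A then 0 else 1

lemma indCompl_of_mem {A : Finset V} {x : V} (h : x ∈ A) : indCompl A x = 0 := by
  simp [indCompl, h]

lemma indCompl_of_notMem {A : Finset V} {x : V} (h : x ∉ A) : indCompl A x = 1 := by
  simp [indCompl, h]

lemma IsSubstochastic.killed {K : Matrix V V ℝ} (hK : IsSubstochastic K) (A : Finset V) :
    IsSubstochastic (killedMat K A) where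
  nonneg x y := by
    simp only [killedMat, Matrix.of_apply]
    split_ifs
    · exact le_rfl
    · exact hK.nonneg x y
  sum_le x := by
    refine (Finset.sum_le_sum fun y _ => ?_).trans (hK.sum_le x)
    simp only [killedMat, Matrix.of_apply]
    split_ifs
    · exact hK.nonneg x y
    · exact le_rfl

lemma IsRev.killed {pd : V → ℝ} {K : Matrix V V ℝ} (h : IsRev pd K) (A : Finset V) :
    IsRev pd (killedMat K A) := by
  intro x y
  simp only [killedMat, Matrix.of_apply, or_comm (a := y ∈ A)]
  split_ifs
  · simp
  · exact h x y

lemma killedMat_mulVec_of_mem (K : Matrix V V ℝ) {A : Finset V} (v : V → ℝ) {x : V}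
    (hx : x ∈ A) : (killedMat K A).mulVec v x = 0 := by
  simp [killedMat, Matrix.mulVec, dotProduct, hx]

lemma heatMat_killedMat_mulVec_of_mem (K : Matrix V V ℝ) {A : Finset V} {v : V → ℝ}
    {x : V} (hx : x ∈ A) (hv : v x = 0) (t : ℝ) :
    (heatMat (killedMat K A) t).mulVec v x = 0 := by
  refine (hasSum_heatMat_mulVec _ t v x).unique ?_
  have e : (fun k => poissonWeight t k * ((killedMat K A ^ k).mulVec v) x) = fun _ => 0 := by
    ext k
    cases k with
    | zero => simp [hv]
    | succ k =>
      rw [pow_succ', ← Matrix.mulVec_mulVec, killedMat_mulVec_of_mem K _ hx, mul_zero]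
  rw [e]
  exact hasSum_zero

/-- Total weight of the discrete paths of length `m` started at `x` that avoid `A`. -/
lemma sum_paths_avoiding (H : Matrix V V ℝ) (A : Finset V) (m : ℕ) (x : V) :
    (∑ y : Fin (m + 1) → V, if ∀ i, y i ∉ A then
      (if y 0 = x then (1 : ℝ) else 0) * ∏ i : Fin m, H (y i.castSucc) (y i.succ) else 0) =
      ((killedMat H A ^ m).mulVec (indCompl A)) x := by
  induction m generalizing x with
  | zero =>
    rw [← (Fin.consEquiv fun _ : Fin 1 => V).sum_comp, Fintype.sum_prod_type]
    simp [Fin.forall_fin_one, indCompl, Fin.consEquiv]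
    rw [Finset.sum_eq_single x]
    · simp
    · intro b _ hb; simp [hb]
    · simp
  | succ m ih =>
    rw [← (Fin.consEquiv fun _ : Fin (m + 2) => V).sum_comp, Fintype.sum_prod_type,
      Finset.sum_eq_single x]
    · rw [pow_succ', ← Matrix.mulVec_mulVec]
      by_cases hx : x ∈ A
      · rw [killedMat_mulVec_of_mem H _ hx]
        refine Finset.sum_eq_zero fun y _ => if_neg fun h => h 0 ?_
        simpa [Fin.consEquiv] using hx
      · simp only [Matrix.mulVec, dotProduct] at ih ⊢
        simp only [← ih, Finset.mul_sum]
        rw [Finset.sum_comm]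
        refine Finset.sum_congr rfl fun y _ => ?_
        rw [Finset.sum_eq_single (y 0)]
        · by_cases hy : ∀ i, y i ∉ A
          · rw [if_pos, if_pos hy]
            · rw [Fin.prod_univ_succ]
              simp [Fin.consEquiv, killedMat, hx, hy 0]
            · intro i
              refine Fin.cases ?_ (fun i => ?_) i
              · simpa [Fin.consEquiv] using hx
              · simpa [Fin.consEquiv] using hy i
          · rw [if_neg, if_neg hy, mul_zero]
            exact fun h => hy fun i => by simpa [Fin.consEquiv] using h i.succ
        · intro z _ hz
          simp [Ne.symm hz]
        · simp
    · intro b _ hb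
      refine Finset.sum_eq_zero fun y _ => ?_
      simp [Fin.consEquiv, hb]
    · simp

/-- Killing at the times of a grid of mesh `h` approximates the killed semigroup. -/
lemma abs_killedMat_pow_sub_le {K : Matrix V V ℝ} (hK : IsSubstochastic K) (A : Finset V) {h : ℝ}
    (hh : 0 ≤ h) (m : ℕ) (x : V) :
    |((killedMat (heatMat K h) A ^ m).mulVec (indCompl A)) x -
      ((heatMat (killedMat K A) h ^ m).mulVec (indCompl A)) x| ≤
        m * (Fintype.card V * h ^ 2) := by
  set F := killedMat (heatMat K h) A with hF
  set G := heatMat (killedMat K A) h with hG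
  have hFs : IsSubstochastic F := (hK.heat hh).killed A
  have hGs : IsSubstochastic G := (hK.killed A).heat hh
  induction m generalizing x with
  | zero => simp
  | succ m ih =>
    set w := (G ^ m).mulVec (indCompl A) with hw
    have hw1 : ∀ y, |w y| ≤ 1 := (hGs.pow m).abs_mulVec_le (fun y => by
      unfold indCompl; split_ifs <;> simp) zero_le_one
    have hw0 : ∀ y ∈ A, w y = 0 := fun y hy => by
      rw [hw, hG, ← heatMat_nat_mul]
      exact heatMat_killedMat_mulVec_of_mem K hy (indCompl_of_mem hy) _
    have hFG : |(F.mulVec w) x - (G.mulVec w) x| ≤ Fintype.card V * h ^ 2 := by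
      by_cases hx : x ∈ A
      · rw [hF, killedMat_mulVec_of_mem _ _ hx, hG,
          heatMat_killedMat_mulVec_of_mem K hx (hw0 x hx)]
        simp only [sub_self, abs_zero]
        positivity
      · simp only [Matrix.mulVec, dotProduct, ← Finset.sum_sub_distrib]
        refine (Finset.abs_sum_le_sum_abs _ _).trans ?_
        refine (Finset.sum_le_card_nsmul _ _ (h ^ 2) fun y _ => ?_).trans_eq (by simp)
        by_cases hy : y ∈ A
        · simp only [hw0 y hy, mul_zero, sub_self, abs_zero]; positivity
        · have hFe : F x y = heatMat K h x y := by simp [hF, killedMat, hx, hy]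
          have hKe : K x y = killedMat K A x y := by simp [killedMat, hx, hy]
          rw [← sub_mul, abs_mul, hFe]
          have h1 := hK.abs_heatMat_sub_le (hK.killed A) hKe hh
          calc _ ≤ h ^ 2 * 1 := mul_le_mul h1 (hw1 y) (abs_nonneg _) (by positivity)
            _ = h ^ 2 := mul_one _
    have hstep := hFs.abs_mulVec_le (v := (F ^ m).mulVec (indCompl A) - w) ih (by positivity) x
    rw [Matrix.mulVec_sub, Pi.sub_apply] at hstep
    rw [pow_succ', pow_succ', ← Matrix.mulVec_mulVec, ← Matrix.mulVec_mulVec, ← hw]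
    calc _ ≤ |F.mulVec ((F ^ m).mulVec (indCompl A)) x - F.mulVec w x| +
          |F.mulVec w x - G.mulVec w x| := abs_sub_le _ _ _
      _ ≤ m * (Fintype.card V * h ^ 2) + Fintype.card V * h ^ 2 := add_le_add hstep hFG
      _ = _ := by push_cast; ring

lemma tendsto_killedMat_pow {K : Matrix V V ℝ} (hK : IsSubstochastic K) (A : Finset V) {t : ℝ}
    (ht : 0 ≤ t) (x : V) :
    Tendsto (fun n : ℕ => ((killedMat (heatMat K (t / (2 ^ n : ℕ))) A ^ (2 ^ n)).mulVec
      (indCompl A)) x) atTop (nhds ((heatMat (killedMat K A) t).mulVec (indCompl A) x)) := by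
  have hlim : Tendsto (fun n : ℕ => Fintype.card V * t ^ 2 * ((2 : ℝ)⁻¹) ^ n) atTop (nhds 0) := by
    simpa using (tendsto_pow_atTop_nhds_zero_of_lt_one (by norm_num : (0 : ℝ) ≤ 2⁻¹)
      (by norm_num)).const_mul (Fintype.card V * t ^ 2)
  rw [tendsto_iff_norm_sub_tendsto_zero]
  refine squeeze_zero (fun _ => norm_nonneg _) (fun n => ?_) hlim
  have h1 := abs_killedMat_pow_sub_le hK A (h := t / (2 ^ n : ℕ)) (by positivity) (2 ^ n) x
  rw [← heatMat_nat_mul, mul_div_cancel₀ _ (by positivity)] at h1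
  rw [Real.norm_eq_abs]
  refine h1.trans_eq ?_
  push_cast
  rw [inv_pow]
  field_simp

end Killed

namespace CTMC

set_option linter.unusedSectionVars false

variable {V : Type} [Fintype V] [DecidableEq V] {K : Matrix V V ℝ}

/-- The event that the chain avoids `A` on `[0, t]`. -/
def surv (W : CTMC V K) (A : Finset V) (t : ℝ) : Set W.Ω :=
  {ω | ∀ s, 0 ≤ s → s ≤ t → W.X s ω ∉ A}

/-- The event that the chain avoids `A` at the times `i t / m`, `i ≤ m`. -/
def gridSurv (W : CTMC V K) (A : Finset V) (t : ℝ) (m : ℕ) : Set W.Ω :=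
  {ω | ∀ i : Fin (m + 1), W.X ((i : ℕ) * (t / m)) ω ∉ A}

lemma measurableSet_notMem (W : CTMC V K) (A : Finset V) (t : ℝ) :
    MeasurableSet[W.mΩ] {ω | W.X t ω ∉ A} := by
  let _ := W.mΩ
  have : {ω | W.X t ω ∉ A} = ⋂ y ∈ A, {ω | W.X t ω = y}ᶜ := by
    ext ω
    simp only [Set.mem_ofPred_eq, Set.mem_iInter, Set.mem_compl_iff]
    exact ⟨fun h y hy e => h (e ▸ hy), fun h hω => h _ hω rfl⟩
  rw [this]
  exact Finset.measurableSet_biInter _ fun y _ => (W.measX t y).compl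

lemma measurableSet_gridSurv (W : CTMC V K) (A : Finset V) (t : ℝ) (m : ℕ) :
    MeasurableSet[W.mΩ] (W.gridSurv A t m) := by
  let _ := W.mΩ
  have : W.gridSurv A t m = ⋂ i : Fin (m + 1), {ω | W.X ((i : ℕ) * (t / m)) ω ∉ A} := by
    ext ω; simp [gridSurv]
  rw [this]
  exact MeasurableSet.iInter fun i => W.measurableSet_notMem A _

lemma surv_subset_gridSurv (W : CTMC V K) (A : Finset V) {t : ℝ} (ht : 0 ≤ t) (m : ℕ) :
    W.surv A t ⊆ W.gridSurv A t m := by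
  intro ω hω i
  refine hω _ (by positivity) ?_
  have hi : ((i : ℕ) : ℝ) ≤ m := by exact_mod_cast Nat.lt_succ_iff.1 i.2
  rcases Nat.eq_zero_or_pos m with rfl | hm
  · simpa using ht
  · calc ((i : ℕ) : ℝ) * (t / m) ≤ m * (t / m) := by gcongr
      _ = t := mul_div_cancel₀ _ (by positivity)

lemma surv_eq_iInter (W : CTMC V K) (A : Finset V) {t : ℝ} (ht : 0 ≤ t) :
    W.surv A t = ⋂ n : ℕ, W.gridSurv A t (2 ^ n) := by
  refine Set.Subset.antisymm
    (Set.subset_iInter fun n => W.surv_subset_gridSurv A ht _) fun ω hω s hs hst hsA => ?_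
  rw [Set.mem_iInter] at hω
  rcases hst.lt_or_eq with hlt | rfl
  · obtain ⟨ε, hε, hX⟩ := W.rightCts ω s
    have ht0 : 0 < t := hs.trans_lt hlt
    obtain ⟨n, hn⟩ := exists_pow_lt_of_lt_one (show 0 < ε / t by positivity)
      (by norm_num : (2 : ℝ)⁻¹ < 1)
    have h2n : (0 : ℝ) < (2 ^ n : ℕ) := by positivity
    set h := t / (2 ^ n : ℕ) with hh
    have hpos : 0 < h := by positivity
    have hlt2 : h < ε := by
      rw [lt_div_iff₀ ht0, inv_pow] at hn
      rw [hh]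
      calc t / (2 ^ n : ℕ) = (2 ^ n)⁻¹ * t := by push_cast; ring
        _ < ε := hn
    have hle : ⌈s / h⌉₊ ≤ 2 ^ n := by
      rw [Nat.ceil_le, div_le_iff₀ hpos, hh, mul_div_cancel₀ _ h2n.ne']
      exact hst
    have h1 := hω n ⟨⌈s / h⌉₊, Nat.lt_succ_iff.2 hle⟩
    simp only [← hh] at h1
    rw [hX] at h1
    · exact h1 hsA
    · exact (div_le_iff₀ hpos).1 (Nat.le_ceil _)
    · have h3 := Nat.ceil_lt_add_one (div_nonneg hs hpos.le)
      calc (⌈s / h⌉₊ : ℝ) * h < (s / h + 1) * h := by gcongr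
        _ = s + h := by field_simp
        _ < s + ε := by linarith
  · have h1 := hω 0 1
    simp at h1
    exact h1 hsA

lemma measurableSet_surv (W : CTMC V K) (A : Finset V) {t : ℝ} (ht : 0 ≤ t) :
    MeasurableSet[W.mΩ] (W.surv A t) := by
  let _ := W.mΩ
  rw [W.surv_eq_iInter A ht]
  exact MeasurableSet.iInter fun n => W.measurableSet_gridSurv A t _

lemma antitone_gridSurv (W : CTMC V K) (A : Finset V) (t : ℝ) :
    Antitone fun n : ℕ => W.gridSurv A t (2 ^ n) := by
  refine antitone_nat_of_succ_le fun n ω hω i => ?_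
  have hi : 2 * (i : ℕ) < 2 ^ (n + 1) + 1 := by
    have := i.2
    rw [pow_succ]; omega
  have h1 := hω ⟨2 * i, hi⟩
  have e : ((2 * (i : ℕ) : ℕ) : ℝ) * (t / (2 ^ (n + 1) : ℕ)) = (i : ℕ) * (t / (2 ^ n : ℕ)) := by
    push_cast; rw [pow_succ]; field_simp
  rwa [e] at h1

lemma prx_gridSurv (W : CTMC V K) (hK : IsSubstochastic K) (A : Finset V) {t : ℝ} (ht : 0 ≤ t)
    (m : ℕ) (x : V) : W.prx x (W.gridSurv A t m) =
      ((killedMat (heatMat K (t / m)) A ^ m).mulVec (indCompl A)) x := by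
  let _ := W.mΩ
  have := W.prob x
  set T : Fin (m + 1) → ℝ := fun i => (i : ℕ) * (t / m) with hT
  have hTmono : Monotone T := fun i j hij => by
    have : ((i : ℕ) : ℝ) ≤ (j : ℕ) := by exact_mod_cast hij
    simp only [hT]; gcongr
  have hset : W.gridSurv A t m = ⋃ y ∈ (Finset.univ.filter fun y : Fin (m + 1) → V => ∀ i, y i ∉ A),
      {ω | ∀ i, W.X (T i) ω = y i} := by
    ext ω
    simp only [gridSurv, Set.mem_ofPred_eq, Finset.mem_filter, Finset.mem_univ, true_and,
      Set.mem_iUnion, exists_prop]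
    exact ⟨fun h => ⟨fun i => W.X (T i) ω, h, fun _ => rfl⟩, fun ⟨y, hy, hXy⟩ i => by
      have := hXy i
      simp only [hT] at this
      rw [this]; exact hy i⟩
  have hmeas : ∀ y : Fin (m + 1) → V, MeasurableSet {ω | ∀ i, W.X (T i) ω = y i} := fun y => by
    rw [Set.ofPred_forall]
    exact MeasurableSet.iInter fun i => W.measX _ _
  have hdisj : Set.PairwiseDisjoint
      (↑(Finset.univ.filter fun y : Fin (m + 1) → V => ∀ i, y i ∉ A) : Set (Fin (m + 1) → V))
      (fun y => {ω | ∀ i, W.X (T i) ω = y i}) := fun y _ z _ hyz =>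
    Set.disjoint_left.2 fun ω h1 h2 => hyz (funext fun i => (h1 i).symm.trans (h2 i))
  have hnn : ∀ y : Fin (m + 1) → V, 0 ≤ (if y 0 = x then (1 : ℝ) else 0) *
      ∏ i : Fin m, heatKer K (T i.succ - T i.castSucc) (y i.castSucc) (y i.succ) := fun y => by
    refine mul_nonneg (by split_ifs <;> norm_num) (Finset.prod_nonneg fun i _ => ?_)
    exact (hK.heat (sub_nonneg.2 (hTmono (Fin.castSucc_lt_succ).le))).nonneg _ _
  rw [← sum_paths_avoiding, ← Finset.sum_filter, prx, hset,
    measure_biUnion_finset hdisj fun y _ => hmeas y, ENNReal.toReal_sum fun _ _ => measure_ne_top _ _]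
  refine Finset.sum_congr rfl fun y _ => ?_
  rw [W.fdd x m T hTmono (by simp [hT]) y, ENNReal.toReal_ofReal (hnn y)]
  congr 1
  refine Finset.prod_congr rfl fun i _ => ?_
  have e : T i.succ - T i.castSucc = t / m := by
    simp only [hT, Fin.val_succ, Fin.val_castSucc]; push_cast; ring
  rw [e]
  rfl

/-- The survival probabilities are given by the killed semigroup. -/
lemma prx_surv (W : CTMC V K) (hK : IsSubstochastic K) (A : Finset V) {t : ℝ} (ht : 0 ≤ t)
    (x : V) : W.prx x (W.surv A t) = (heatMat (killedMat K A) t).mulVec (indCompl A) x := by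
  let _ := W.mΩ
  have := W.prob x
  have h1 : Tendsto (fun n : ℕ => W.prx x (W.gridSurv A t (2 ^ n))) atTop
      (nhds (W.prx x (W.surv A t))) := by
    rw [W.surv_eq_iInter A ht]
    exact (ENNReal.tendsto_toReal (measure_ne_top _ _)).comp
      (tendsto_measure_iInter_atTop (fun n => (W.measurableSet_gridSurv A t _).nullMeasurableSet)
        (W.antitone_gridSurv A t) ⟨0, measure_ne_top _ _⟩)
  refine tendsto_nhds_unique h1 ?_
  simp only [W.prx_gridSurv hK A ht]
  exact tendsto_killedMat_pow hK A ht x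

lemma surv_iff_lt_hit (W : CTMC V K) (A : Finset V) {ω : W.Ω} {s0 : ℝ} (hs0 : 0 ≤ s0)
    (hA : W.X s0 ω ∈ A) {t : ℝ} : ω ∈ W.surv A t ↔ t < W.hit (↑A) ω := by
  set S : Set ℝ := {t : ℝ | 0 ≤ t ∧ W.X t ω ∈ (↑A : Set V)} with hS
  have hne : S.Nonempty := ⟨s0, hs0, hA⟩
  have hbdd : BddBelow S := ⟨0, fun s hs => hs.1⟩
  have hmem : sInf S ∈ S := by
    refine ⟨le_csInf hne fun s hs => hs.1, ?_⟩
    obtain ⟨ε, hε, hX⟩ := W.rightCts ω (sInf S)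
    obtain ⟨s, hsS, hs⟩ := exists_lt_of_csInf_lt hne (show sInf S < sInf S + ε by linarith)
    rw [← hX s (csInf_le hbdd hsS) hs]
    exact hsS.2
  constructor
  · intro h
    by_contra! hle
    exact h _ hmem.1 hle hmem.2
  · intro h s hs hst hsA
    exact absurd (csInf_le hbdd (show s ∈ S from ⟨hs, hsA⟩)) (not_le.2 (hst.trans_lt h))

/-- The event that the chain never visits `A`. -/
def neverHit (W : CTMC V K) (A : Finset V) : Set W.Ω := ⋂ n : ℕ, W.surv A n

lemma measurableSet_neverHit (W : CTMC V K) (A : Finset V) :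
    MeasurableSet[W.mΩ] (W.neverHit A) := by
  let _ := W.mΩ
  exact MeasurableSet.iInter fun n => W.measurableSet_surv A n.cast_nonneg

lemma lt_hit_eq_diff (W : CTMC V K) (A : Finset V) {t : ℝ} (ht : 0 ≤ t) :
    {ω | t < W.hit (↑A) ω} = W.surv A t \ W.neverHit A := by
  ext ω
  by_cases h : ∃ s0, 0 ≤ s0 ∧ W.X s0 ω ∈ A
  · obtain ⟨s0, hs0, hA⟩ := h
    have h1 : ω ∉ W.neverHit A := fun h => by
      obtain ⟨n, hn⟩ := exists_nat_ge s0
      exact Set.mem_iInter.1 h n s0 hs0 hn hA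
    simp [h1, W.surv_iff_lt_hit A hs0 hA]
  · push Not at h
    have h1 : ω ∈ W.neverHit A := Set.mem_iInter.2 fun n s hs _ => h s hs
    have h2 : {t : ℝ | 0 ≤ t ∧ W.X t ω ∈ (↑A : Set V)} = ∅ :=
      Set.eq_empty_of_forall_notMem fun s hs => h s hs.1 hs.2
    have h3 : W.hit (↑A) ω = 0 := by rw [hit, h2, Real.sInf_empty]
    simp [h1, h3, ht]

lemma hit_nonneg (W : CTMC V K) (A : Finset V) (ω : W.Ω) : 0 ≤ W.hit (↑A) ω :=
  Real.sInf_nonneg fun _ hs => hs.1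

lemma measurable_hit (W : CTMC V K) (A : Finset V) : Measurable[W.mΩ] (W.hit (↑A)) := by
  let _ := W.mΩ
  refine measurable_of_Ioi fun t => ?_
  rcases le_or_gt 0 t with ht | ht
  · change MeasurableSet {ω | t < W.hit (↑A) ω}
    rw [W.lt_hit_eq_diff A ht]
    exact (W.measurableSet_surv A ht).diff (W.measurableSet_neverHit A)
  · convert MeasurableSet.univ
    exact Set.eq_univ_of_forall fun ω => ht.trans_le (W.hit_nonneg A ω)

end CTMC

namespace CTMC

set_option linter.unusedSectionVars false

variable {V : Type} [Fintype V] [DecidableEq V] {K : Matrix V V ℝ}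

/-- The survival function of the hitting time, when the chain hits `A` almost surely. -/
lemma prx_lt_hit (W : CTMC V K) (hK : IsSubstochastic K) (A : Finset V) (x : V)
    (hlim : Tendsto (fun t : ℝ => (heatMat (killedMat K A) t).mulVec (indCompl A) x) atTop (nhds 0))
    {t : ℝ} (ht : 0 ≤ t) :
    W.prx x {ω | t < W.hit (↑A) ω} = (heatMat (killedMat K A) t).mulVec (indCompl A) x := by
  let _ := W.mΩ
  have := W.prob x
  have h0 : W.prx x (W.neverHit A) = 0 := by
    refine le_antisymm (ge_of_tendsto' (hlim.comp tendsto_natCast_atTop_atTop) fun n => ?_)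
      ENNReal.toReal_nonneg
    simp only [Function.comp_apply]
    rw [← W.prx_surv hK A n.cast_nonneg]
    exact ENNReal.toReal_mono (measure_ne_top _ _) (measure_mono (Set.iInter_subset _ n))
  have h0' : W.P x (W.neverHit A) = 0 :=
    (ENNReal.toReal_eq_zero_iff _).1 h0 |>.resolve_right (measure_ne_top _ _)
  rw [W.lt_hit_eq_diff A ht, prx, measure_sdiff_null h0']
  exact W.prx_surv hK A ht x

lemma hit_tail_and_ex_of_exp_decay (W : CTMC V K) (hK : IsSubstochastic K) (A : Finset V) (x : V)
    {C c : ℝ} (hc : 0 < c) (hdec : ∀ t, 0 ≤ t →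
      (heatMat (killedMat K A) t).mulVec (indCompl A) x ≤ C * Real.exp (-c * t)) :
    IntegrableOn (fun t => (heatMat (killedMat K A) t).mulVec (indCompl A) x) (Set.Ioi 0) ∧
      (∀ t, 0 ≤ t → W.prx x {ω | t < W.hit (↑A) ω} =
        (heatMat (killedMat K A) t).mulVec (indCompl A) x) ∧
      W.ex x (W.hit ↑A) =
        ∫ t in Set.Ioi (0 : ℝ), (heatMat (killedMat K A) t).mulVec (indCompl A) x := by
  let _ := W.mΩ
  have := W.prob x
  set s : ℝ → ℝ := fun t => (heatMat (killedMat K A) t).mulVec (indCompl A) x with hs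
  have hs0 : ∀ t, 0 ≤ t → 0 ≤ s t := fun t ht => by
    simp only [hs]
    rw [← W.prx_surv hK A ht]
    exact ENNReal.toReal_nonneg
  have hinteg : IntegrableOn s (Set.Ioi 0) := by
    refine Integrable.mono' ((exp_neg_integrableOn_Ioi 0 hc).const_mul C)
      (continuous_heatMat_mulVec _ _ x).aestronglyMeasurable ?_
    refine (ae_restrict_iff' measurableSet_Ioi).2 (ae_of_all _ fun t (ht : 0 < t) => ?_)
    rw [Real.norm_of_nonneg (hs0 t ht.le)]
    exact hdec t ht.le
  have hlim : Tendsto s atTop (nhds 0) := by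
    have h1 : Tendsto (fun t => C * Real.exp (-c * t)) atTop (nhds 0) := by
      have h2 : Tendsto (fun t => -c * t) atTop atBot :=
        tendsto_id.const_mul_atTop_of_neg (neg_lt_zero.2 hc)
      simpa using (Real.tendsto_exp_atBot.comp h2).const_mul C
    refine tendsto_of_tendsto_of_tendsto_of_le_of_le' tendsto_const_nhds h1 ?_ ?_
    · filter_upwards [eventually_ge_atTop 0] with t ht using hs0 t ht
    · filter_upwards [eventually_ge_atTop 0] with t ht using hdec t ht
  have hprob : ∀ t, 0 ≤ t → W.prx x {ω | t < W.hit (↑A) ω} = s t := fun t ht =>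
    W.prx_lt_hit hK A x hlim ht
  have hT0 : 0 ≤ᵐ[W.P x] W.hit (↑A) := ae_of_all _ (W.hit_nonneg A)
  have hTint : Integrable (W.hit (↑A)) (W.P x) := by
    refine ⟨(W.measurable_hit A).aestronglyMeasurable, ?_⟩
    rw [hasFiniteIntegral_iff_ofReal hT0,
      lintegral_eq_lintegral_meas_lt _ hT0 (W.measurable_hit A).aemeasurable]
    have h1 : ∫⁻ t in Set.Ioi (0 : ℝ), W.P x {ω | t < W.hit (↑A) ω} =
        ∫⁻ t in Set.Ioi (0 : ℝ), ENNReal.ofReal (s t) :=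
      setLIntegral_congr_fun measurableSet_Ioi fun t ht => by
        rw [← hprob t (le_of_lt ht), prx, ENNReal.ofReal_toReal (measure_ne_top _ _)]
    rw [h1]
    exact (hasFiniteIntegral_iff_ofReal ((ae_restrict_iff' measurableSet_Ioi).2
      (ae_of_all _ fun t (ht : 0 < t) => hs0 t ht.le))).1 hinteg.2
  refine ⟨hinteg, hprob, ?_⟩
  rw [ex, hTint.integral_eq_integral_meas_lt hT0]
  exact setIntegral_congr_fun measurableSet_Ioi fun t ht => hprob t (le_of_lt ht)

end CTMC

section Spectral

set_option linter.unusedSectionVars false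

variable {V : Type} [Fintype V] [DecidableEq V] {K : Matrix V V ℝ} {pd : V → ℝ}

/-- The functions orthogonal to `f` with respect to the weights `pd`. -/
def orthSubmodule (pd f : V → ℝ) : Submodule ℝ (V → ℝ) where
  carrier := {g | wInner pd f g = 0}
  add_mem' {u v} hu hv := by
    simp only [Set.mem_ofPred_eq] at *
    rw [wInner_add_right, hu, hv, add_zero]
  zero_mem' := by simp [wInner]
  smul_mem' c u hu := by
    simp only [Set.mem_ofPred_eq] at *
    rw [wInner_smul_right, hu, mul_zero]

lemma mem_orthSubmodule {f g : V → ℝ} : g ∈ orthSubmodule pd f ↔ wInner pd f g = 0 := Iff.rfl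

/-- The functions vanishing on `A`. -/
def vanishSubmodule (A : Finset V) : Submodule ℝ (V → ℝ) where
  carrier := {g | ∀ v ∈ A, g v = 0}
  add_mem' {u v} hu hv x hx := by simp [hu x hx, hv x hx]
  zero_mem' _ _ := rfl
  smul_mem' c u hu x hx := by simp [hu x hx]

lemma energy_killedMat {A : Finset V} {u : V → ℝ} (hu : u ∈ vanishSubmodule A) :
    energy pd (killedMat K A) u = energy pd K u := by
  unfold energy wInner
  refine Finset.sum_congr rfl fun x _ => ?_
  by_cases hx : x ∈ A
  · simp [hu x hx]
  · have : (killedMat K A).mulVec u x = K.mulVec u x := by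
      simp only [Matrix.mulVec, dotProduct]
      refine Finset.sum_congr rfl fun y _ => ?_
      by_cases hy : y ∈ A
      · simp [hu y hy]
      · simp [killedMat, hx, hy]
    simp [this]

lemma energy_eq_sum_sq (hK1 : ∀ x, ∑ y, K x y = 1) (hrev : IsRev pd K) (u : V → ℝ) :
    2 * energy pd K u = ∑ x, ∑ y, pd x * K x y * (u x - u y) ^ 2 := by
  have h1 : ∑ x, ∑ y, pd x * K x y * u x ^ 2 = wInner pd u u := by
    refine Finset.sum_congr rfl fun x _ => ?_
    rw [← Finset.sum_mul, ← Finset.mul_sum, hK1]; ring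
  have h2 : ∑ x, ∑ y, pd x * K x y * u y ^ 2 = wInner pd u u := by
    rw [← h1, Finset.sum_comm]
    refine Finset.sum_congr rfl fun x _ => Finset.sum_congr rfl fun y _ => ?_
    rw [hrev]
  have h3 : ∑ x, ∑ y, pd x * K x y * (u x * u y) = wInner pd u (K.mulVec u) := by
    simp only [wInner, Matrix.mulVec, dotProduct, Finset.mul_sum]
    refine Finset.sum_congr rfl fun x _ => Finset.sum_congr rfl fun y _ => ?_
    ring
  calc 2 * energy pd K u = wInner pd u u + wInner pd u u - 2 * wInner pd u (K.mulVec u) := by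
        rw [energy, wInner_sub_right]; ring
    _ = _ := by
        conv_lhs => rw [← h3]; arg 1; arg 1; rw [← h1]
        rw [← h2]
        simp only [Finset.mul_sum, ← Finset.sum_add_distrib, ← Finset.sum_sub_distrib]
        refine Finset.sum_congr rfl fun x _ => Finset.sum_congr rfl fun y _ => ?_
        ring

/-- For an irreducible chain, only constants have nonpositive energy. -/
lemma eq_of_energy_nonpos (hpd : ∀ x, 0 < pd x) (hK0 : ∀ x y, 0 ≤ K x y)
    (hK1 : ∀ x, ∑ y, K x y = 1) (hirr : ∀ x y, ∃ k : ℕ, 0 < (K ^ k) x y) (hrev : IsRev pd K)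
    {u : V → ℝ} (hu : energy pd K u ≤ 0) (x y : V) : u x = u y := by
  have hnn : ∀ x y, 0 ≤ pd x * K x y * (u x - u y) ^ 2 := fun x y =>
    mul_nonneg (mul_nonneg (hpd x).le (hK0 x y)) (sq_nonneg _)
  have h0 : ∑ x, ∑ y, pd x * K x y * (u x - u y) ^ 2 = 0 := by
    refine le_antisymm ?_ (Finset.sum_nonneg fun x _ => Finset.sum_nonneg fun y _ => hnn x y)
    rw [← energy_eq_sum_sq hK1 hrev]; linarith
  have hstep : ∀ x y, 0 < K x y → u x = u y := by
    intro x y hxy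
    have h1 := (Finset.sum_eq_zero_iff_of_nonneg fun x _ =>
      Finset.sum_nonneg fun y _ => hnn x y).1 h0 x (Finset.mem_univ x)
    have h2 := (Finset.sum_eq_zero_iff_of_nonneg fun y _ => hnn x y).1 h1 y (Finset.mem_univ y)
    have h3 : pd x * K x y ≠ 0 := (mul_pos (hpd x) hxy).ne'
    have h4 := (mul_eq_zero.1 h2).resolve_left h3
    exact sub_eq_zero.1 (pow_eq_zero_iff two_ne_zero |>.1 h4)
  have hpow : ∀ (k : ℕ) (x y : V), (K ^ k) x y ≠ 0 → u x = u y := by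
    intro k
    induction k with
    | zero =>
      intro x y h
      by_contra hne
      exact h (by simp [show x ≠ y from fun e => hne (e ▸ rfl)])
    | succ k ih =>
      intro x y h
      rw [pow_succ, Matrix.mul_apply] at h
      obtain ⟨z, -, hz⟩ := Finset.exists_ne_zero_of_sum_ne_zero h
      exact (ih x z (left_ne_zero_of_mul hz)).trans
        (hstep z y ((hK0 z y).lt_of_ne (right_ne_zero_of_mul hz).symm))
  obtain ⟨k, hk⟩ := hirr x y
  exact hpow k x y hk.ne'

lemma wInner_one_left (g : V → ℝ) : wInner pd 1 g = ∑ x, pd x * g x := by simp [wInner]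

/-- The spectral gap of an irreducible reversible chain is positive, and satisfies the Poincaré
inequality. -/
lemma specGap_pos_and_poincare [Nontrivial V] (hpd : ∀ x, 0 < pd x) (hK0 : ∀ x y, 0 ≤ K x y)
    (hK1 : ∀ x, ∑ y, K x y = 1) (hirr : ∀ x y, ∃ k : ℕ, 0 < (K ^ k) x y) (hrev : IsRev pd K) :
    0 < specGap K pd ∧
      ∀ u, wInner pd 1 u = 0 → specGap K pd * wInner pd u u ≤ energy pd K u := by
  obtain ⟨b, c, hbc⟩ := exists_pair_ne V
  have hU : orthSubmodule pd 1 ≠ ⊥ := by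
    refine (Submodule.ne_bot_iff _).2 ⟨Pi.single b (pd c) - Pi.single c (pd b), ?_, fun h => ?_⟩
    · rw [mem_orthSubmodule, wInner_sub_right, wInner_one_left, wInner_one_left]
      simp [Pi.single_apply, mul_comm]
    · have := congrFun h b
      simp [hbc, (hpd c).ne'] at this
  have hone : K.mulVec 1 = 1 := by
    ext x; simp [Matrix.mulVec, dotProduct, hK1]
  obtain ⟨r, g, hgU, hg0, hg, hray⟩ := hrev.exists_rayleigh_min hpd hU fun u hu => by
    rw [mem_orthSubmodule] at *
    rw [hrev.wInner_mulVec, hone, hu]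
  have hleast : IsLeast {r : ℝ | ∃ g : V → ℝ, g ≠ 0 ∧ (∑ x : V, pd x * g x = 0) ∧
      ∀ y : V, ∑ x : V, K y x * g x = (1 - r) * g y} r := by
    refine ⟨⟨g, hg0, by rw [← wInner_one_left]; exact hgU, fun y => congrFun hg y⟩, ?_⟩
    rintro r' ⟨g', hg'0, hg'U, hg'⟩
    have h1 := hray g' (by rw [mem_orthSubmodule, wInner_one_left]; exact hg'U)
    rw [energy_eigen pd (r := r') (funext hg')] at h1
    exact le_of_mul_le_mul_right h1
      ((wInner_self_nonneg hpd g').lt_of_ne fun h => hg'0 (wInner_self_eq_zero hpd h.symm))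
  have hgap : specGap K pd = r := hleast.csInf_eq
  rw [hgap]
  refine ⟨?_, fun u hu => hray u hu⟩
  by_contra! hr
  have h1 : energy pd K g ≤ 0 := by
    rw [energy_eigen pd hg]
    exact mul_nonpos_of_nonpos_of_nonneg hr (wInner_self_nonneg hpd g)
  have h2 := eq_of_energy_nonpos hpd hK0 hK1 hirr hrev h1
  refine hg0 (wInner_self_eq_zero hpd ?_)
  have h3 : g = g b • (1 : V → ℝ) := by ext x; simpa using h2 x b
  conv_lhs => arg 2; rw [h3]
  rw [wInner_smul_left, mem_orthSubmodule.1 hgU, mul_zero]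

variable {A : Finset V} {a : V → ℝ} {lam : ℝ}

lemma IsQSD.mulVec_density (hQ : IsQSD K A a lam) (hpd : ∀ x, 0 < pd x) (hrev : IsRev pd K) :
    (killedMat K A).mulVec (fun x => a x / pd x) = (1 - lam) • fun x => a x / pd x := by
  ext y
  simp only [Matrix.mulVec, dotProduct, Pi.smul_apply, smul_eq_mul]
  rw [← mul_div_assoc, ← hQ.eigen y, Finset.sum_div]
  refine Finset.sum_congr rfl fun x _ => ?_
  have h1 := hrev.killed A x y
  have := (hpd x).ne'
  have := (hpd y).ne'
  field_simp
  linear_combination -(a x) * h1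

lemma IsQSD.density_mem (hQ : IsQSD K A a lam) :
    (fun x => a x / pd x) ∈ vanishSubmodule A := fun v hv => by simp [hQ.supported v hv]

lemma IsQSD.density_ne_zero (hQ : IsQSD K A a lam) (hpd : ∀ x, 0 < pd x) :
    (fun x => a x / pd x) ≠ 0 := fun h => by
  have h1 : ∀ x, a x = 0 := fun x => by
    have := congrFun h x
    simpa [(hpd x).ne'] using this
  have := hQ.sum_one
  simp [h1] at this

lemma IsQSD.rate_pos (hQ : IsQSD K A a lam) (hA : A.Nonempty) (hpd : ∀ x, 0 < pd x)
    (hK0 : ∀ x y, 0 ≤ K x y) (hK1 : ∀ x, ∑ y, K x y = 1)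
    (hirr : ∀ x y, ∃ k : ℕ, 0 < (K ^ k) x y) (hrev : IsRev pd K) : 0 < lam := by
  by_contra! hl
  obtain ⟨v, hv⟩ := hA
  have h1 : energy pd K (fun x => a x / pd x) ≤ 0 := by
    rw [← energy_killedMat hQ.density_mem, energy_eigen pd (hQ.mulVec_density hpd hrev)]
    exact mul_nonpos_of_nonpos_of_nonneg hl (wInner_self_nonneg hpd _)
  refine hQ.density_ne_zero hpd (funext fun x => ?_)
  exact (eq_of_energy_nonpos hpd hK0 hK1 hirr hrev h1 x v).trans (hQ.density_mem v hv)

lemma IsQSD.rayleigh (hQ : IsQSD K A a lam) (hpd : ∀ x, 0 < pd x) (hrev : IsRev pd K)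
    {u : V → ℝ} (hu : u ∈ vanishSubmodule A) :
    lam * wInner pd u u ≤ energy pd (killedMat K A) u := by
  obtain ⟨r, g, hgU, hg0, hg, hray⟩ := (hrev.killed A).exists_rayleigh_min hpd
    (U := vanishSubmodule A)
    ((Submodule.ne_bot_iff _).2 ⟨_, hQ.density_mem (pd := pd), hQ.density_ne_zero hpd⟩)
    (fun u _ v hv => killedMat_mulVec_of_mem K u hv)
  have hle : lam ≤ r := by
    refine hQ.minimal r (fun x => pd x * g x) (fun h => hg0 (funext fun x => ?_))
      (fun v hv => by simp [hgU v hv]) fun y => ?_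
    · simpa [(hpd x).ne'] using congrFun h x
    · have h1 := congrFun hg y
      simp only [Matrix.mulVec, dotProduct, Pi.smul_apply, smul_eq_mul] at h1
      calc ∑ x, pd x * g x * killedMat K A x y = ∑ x, pd y * (killedMat K A y x * g x) :=
            Finset.sum_congr rfl fun x _ => by linear_combination g x * hrev.killed A x y
        _ = (1 - r) * (pd y * g y) := by rw [← Finset.mul_sum, h1]; ring
  exact (mul_le_mul_of_nonneg_right hle (wInner_self_nonneg hpd u)).trans (hray u hu)

/-- Orthogonally to the quasi-stationary density, the killed chain has gap at least that of the
original chain. -/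
lemma IsQSD.gap_le_energy_of_orth (hQ : IsQSD K A a lam) (hpd : ∀ x, 0 < pd x)
    (hrev : IsRev pd K) {c : ℝ}
    (hc : ∀ u, wInner pd 1 u = 0 → c * wInner pd u u ≤ energy pd K u)
    {u : V → ℝ} (hu : u ∈ vanishSubmodule A) (horth : wInner pd (fun x => a x / pd x) u = 0) :
    c * wInner pd u u ≤ energy pd (killedMat K A) u := by
  set f : V → ℝ := fun x => a x / pd x with hf
  rcases le_total c lam with h | h
  · exact (mul_le_mul_of_nonneg_right h (wInner_self_nonneg hpd u)).trans (hQ.rayleigh hpd hrev hu)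
  · have hf1 : wInner pd 1 f = 1 := by
      rw [wInner_one_left, ← hQ.sum_one]
      exact Finset.sum_congr rfl fun x _ => mul_div_cancel₀ _ (hpd x).ne'
    set m := wInner pd 1 u with hm
    have hw : u + (-m) • f ∈ vanishSubmodule A :=
      add_mem hu (Submodule.smul_mem _ _ hQ.density_mem)
    have h1 := hc (u + (-m) • f) (by rw [wInner_add_right, wInner_smul_right, hf1]; ring)
    have hfe := hQ.mulVec_density hpd hrev
    have h2 : wInner pd f (u - (killedMat K A).mulVec u) = 0 := by
      rw [wInner_sub_right, (hrev.killed A).wInner_mulVec, hfe, wInner_smul_left, horth]; ring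
    rw [← energy_killedMat hw, (hrev.killed A).energy_add_smul, h2, energy_eigen pd hfe] at h1
    have h3 : wInner pd (u + (-m) • f) (u + (-m) • f) = wInner pd u u + m ^ 2 * wInner pd f f := by
      simp only [wInner_add_left, wInner_add_right, wInner_smul_left, wInner_smul_right,
        wInner_comm pd u f, horth]
      ring
    rw [h3] at h1
    have h4 : lam * (m ^ 2 * wInner pd f f) ≤ c * (m ^ 2 * wInner pd f f) :=
      mul_le_mul_of_nonneg_right h (mul_nonneg (sq_nonneg m) (wInner_self_nonneg hpd f))
    nlinarith

end Spectral

section HittingTime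

set_option linter.unusedSectionVars false

variable {V : Type} [Fintype V] [DecidableEq V] {K : Matrix V V ℝ} {pd : V → ℝ}
variable {A : Finset V} {a : V → ℝ} {lam : ℝ}

lemma indCompl_mem_vanishSubmodule (A : Finset V) : indCompl A ∈ vanishSubmodule A :=
  fun _ hv => indCompl_of_mem hv

lemma heatMat_killedMat_mem_vanishSubmodule (K : Matrix V V ℝ) {g : V → ℝ}
    (hg : g ∈ vanishSubmodule A) (t : ℝ) :
    (heatMat (killedMat K A) t).mulVec g ∈ vanishSubmodule A :=
  fun _ hv => heatMat_killedMat_mulVec_of_mem K hv (hg _ hv) t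

lemma wInner_indCompl (pd : V → ℝ) {g : V → ℝ} (hg : g ∈ vanishSubmodule A) :
    wInner pd (indCompl A) g = ∑ x, pd x * g x := by
  refine Finset.sum_congr rfl fun x _ => ?_
  by_cases hx : x ∈ A
  · simp [hg x hx]
  · simp [indCompl_of_notMem hx]

lemma wInner_indCompl_self (hpd1 : ∑ x, pd x = 1) :
    wInner pd (indCompl A) (indCompl A) = 1 - ∑ v ∈ A, pd v := by
  rw [wInner_indCompl pd (indCompl_mem_vanishSubmodule A), ← hpd1,
    ← Finset.sum_compl_add_sum A pd, add_sub_cancel_right,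
    ← Finset.sum_compl_add_sum A fun x => pd x * indCompl A x]
  rw [Finset.sum_eq_zero (s := A) fun x hx => by rw [indCompl_of_mem hx, mul_zero], add_zero]
  exact Finset.sum_congr rfl fun x hx => by
    rw [indCompl_of_notMem (Finset.mem_compl.1 hx), mul_one]

lemma wInner_density (hpd : ∀ x, 0 < pd x) (a g : V → ℝ) :
    wInner pd (fun x => a x / pd x) g = ∑ x, a x * g x :=
  Finset.sum_congr rfl fun x _ => by
    have := (hpd x).ne'
    field_simp

lemma IsQSD.wInner_density_indCompl (hQ : IsQSD K A a lam) (hpd : ∀ x, 0 < pd x) :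
    wInner pd (fun x => a x / pd x) (indCompl A) = 1 := by
  rw [wInner_comm, wInner_indCompl pd hQ.density_mem, ← hQ.sum_one]
  exact Finset.sum_congr rfl fun x _ => mul_div_cancel₀ _ (hpd x).ne'

/-- Under the quasi-stationary distribution the killed semigroup decays exactly exponentially. -/
lemma IsQSD.wInner_density_heatMat (hQ : IsQSD K A a lam) (hpd : ∀ x, 0 < pd x)
    (hrev : IsRev pd K) (g : V → ℝ) (t : ℝ) :
    wInner pd (fun x => a x / pd x) ((heatMat (killedMat K A) t).mulVec g) =
      Real.exp (-(lam * t)) * wInner pd (fun x => a x / pd x) g := by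
  rw [((hrev.killed A).heat t).wInner_mulVec, heatMat_mulVec_eigen (hQ.mulVec_density hpd hrev),
    wInner_smul_left, sub_sub_cancel]

lemma IsQSD.wInner_indCompl_heatMat_bounds (hQ : IsQSD K A a lam) (hpd : ∀ x, 0 < pd x)
    (hrev : IsRev pd K) {t : ℝ} (ht : 0 ≤ t) :
    0 ≤ wInner pd (indCompl A) ((heatMat (killedMat K A) t).mulVec (indCompl A)) ∧
      wInner pd (indCompl A) ((heatMat (killedMat K A) t).mulVec (indCompl A)) ≤
        wInner pd (indCompl A) (indCompl A) * Real.exp (-(lam * t)) :=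
  (hrev.killed A).wInner_heatMat_bounds hpd (fun t => hQ.rayleigh hpd hrev
    (heatMat_killedMat_mem_vanishSubmodule K (indCompl_mem_vanishSubmodule A) t)) ht

/-- Removing the quasi-stationary component of the indicator of the complement of `A`, the
rest of the killed semigroup decays at the rate of the spectral gap. -/
lemma IsQSD.wInner_indCompl_heatMat_sub_bounds (hQ : IsQSD K A a lam) (hpd : ∀ x, 0 < pd x)
    (hrev : IsRev pd K) {c : ℝ}
    (hc : ∀ u, wInner pd 1 u = 0 → c * wInner pd u u ≤ energy pd K u) {N : ℝ}
    (hN : N = wInner pd (fun x => a x / pd x) fun x => a x / pd x) {t : ℝ} (ht : 0 ≤ t) :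
    0 ≤ wInner pd (indCompl A) ((heatMat (killedMat K A) t).mulVec (indCompl A)) -
        N⁻¹ * Real.exp (-(lam * t)) ∧
      wInner pd (indCompl A) ((heatMat (killedMat K A) t).mulVec (indCompl A)) -
        N⁻¹ * Real.exp (-(lam * t)) ≤
        (wInner pd (indCompl A) (indCompl A) - N⁻¹) * Real.exp (-(c * t)) := by
  set f : V → ℝ := fun x => a x / pd x with hf
  have hN0 : N ≠ 0 := fun h => hQ.density_ne_zero hpd (wInner_self_eq_zero hpd (hN ▸ h))
  have hf1 : wInner pd f (indCompl A) = 1 := hQ.wInner_density_indCompl hpd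
  set g : V → ℝ := indCompl A - N⁻¹ • f with hg
  have hgmem : g ∈ vanishSubmodule A :=
    sub_mem (indCompl_mem_vanishSubmodule A) (Submodule.smul_mem _ _ hQ.density_mem)
  have horth : wInner pd f g = 0 := by
    rw [hg, wInner_sub_right, wInner_smul_right, hf1, ← hN, inv_mul_cancel₀ hN0, sub_self]
  have horth' : ∀ t, wInner pd f ((heatMat (killedMat K A) t).mulVec g) = 0 := fun t => by
    rw [hQ.wInner_density_heatMat hpd hrev, horth, mul_zero]
  have hgH : ∀ t, wInner pd g ((heatMat (killedMat K A) t).mulVec g) =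
      wInner pd (indCompl A) ((heatMat (killedMat K A) t).mulVec (indCompl A)) -
        N⁻¹ * Real.exp (-(lam * t)) := fun t => by
    have h1 : wInner pd (indCompl A) f = 1 := by rw [wInner_comm, hf1]
    rw [hg, wInner_sub_left, wInner_smul_left, ← hg, horth', mul_zero, sub_zero, hg,
      Matrix.mulVec_sub, Matrix.mulVec_smul, heatMat_mulVec_eigen (hQ.mulVec_density hpd hrev),
      wInner_sub_right, wInner_smul_right, wInner_smul_right, ← hf, h1, mul_one, sub_sub_cancel]
  have hgg : wInner pd g g = wInner pd (indCompl A) (indCompl A) - N⁻¹ := by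
    have := hgH 0
    rwa [heatMat_zero, Matrix.one_mulVec, Matrix.one_mulVec, mul_zero, neg_zero, Real.exp_zero,
      mul_one] at this
  rw [← hgH, ← hgg]
  exact (hrev.killed A).wInner_heatMat_bounds hpd (fun t => hQ.gap_le_energy_of_orth hpd hrev hc
    (heatMat_killedMat_mem_vanishSubmodule K hgmem t) (horth' t)) ht

lemma CTMC.killed_nonneg (W : CTMC V K) (hK : IsSubstochastic K) (A : Finset V) {t : ℝ}
    (ht : 0 ≤ t) (x : V) : 0 ≤ (heatMat (killedMat K A) t).mulVec (indCompl A) x := by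
  rw [← W.prx_surv hK A ht]
  exact ENNReal.toReal_nonneg

/-- Pointwise exponential decay of the killed semigroup, deduced from its decay on average. -/
lemma IsQSD.heatMat_killedMat_le (hQ : IsQSD K A a lam) (W : CTMC V K) (hK : IsSubstochastic K)
    (hpd : ∀ x, 0 < pd x) (hrev : IsRev pd K) (x : V) {t : ℝ} (ht : 0 ≤ t) :
    (heatMat (killedMat K A) t).mulVec (indCompl A) x ≤
      wInner pd (indCompl A) (indCompl A) / pd x * Real.exp (-lam * t) := by
  rw [div_mul_eq_mul_div, le_div_iff₀' (hpd x), neg_mul]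
  refine le_trans ?_ (hQ.wInner_indCompl_heatMat_bounds hpd hrev ht).2
  rw [wInner_indCompl pd
    (heatMat_killedMat_mem_vanishSubmodule K (indCompl_mem_vanishSubmodule A) t)]
  exact Finset.single_le_sum
    (f := fun x => pd x * (heatMat (killedMat K A) t).mulVec (indCompl A) x)
    (fun y _ => mul_nonneg (hpd y).le (W.killed_nonneg hK A ht y)) (Finset.mem_univ x)

lemma integral_exp_neg_mul_Ioi_zero {c : ℝ} (hc : 0 < c) :
    ∫ t in Set.Ioi (0 : ℝ), Real.exp (-(c * t)) = c⁻¹ := by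
  simp_rw [← neg_mul]
  rw [integral_exp_mul_Ioi (neg_lt_zero.2 hc), mul_zero, Real.exp_zero, neg_div_neg_eq, one_div]

lemma integrableOn_exp_neg_mul_Ioi_zero {c : ℝ} (hc : 0 < c) :
    IntegrableOn (fun t => Real.exp (-(c * t))) (Set.Ioi (0 : ℝ)) := by
  simpa only [neg_mul] using exp_neg_integrableOn_Ioi 0 hc

/-- Integrating an exponentially small error bound. -/
lemma integral_sub_exp_bounds {S : ℝ → ℝ} {m M b c : ℝ} (hb : 0 < b) (hc : 0 < c)
    (hS : IntegrableOn S (Set.Ioi 0))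
    (h : ∀ t, 0 ≤ t → 0 ≤ S t - m * Real.exp (-(b * t)) ∧
      S t - m * Real.exp (-(b * t)) ≤ M * Real.exp (-(c * t))) :
    0 ≤ (∫ t in Set.Ioi (0 : ℝ), S t) - m * b⁻¹ ∧
      (∫ t in Set.Ioi (0 : ℝ), S t) - m * b⁻¹ ≤ M * c⁻¹ := by
  have hb' := (integrableOn_exp_neg_mul_Ioi_zero hb).const_mul m
  have hc' := (integrableOn_exp_neg_mul_Ioi_zero hc).const_mul M
  have h1 : (∫ t in Set.Ioi (0 : ℝ), (S t - m * Real.exp (-(b * t)))) =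
      (∫ t in Set.Ioi (0 : ℝ), S t) - m * b⁻¹ := by
    rw [integral_sub hS hb', integral_const_mul, integral_exp_neg_mul_Ioi_zero hb]
  rw [← h1, ← integral_exp_neg_mul_Ioi_zero hc, ← integral_const_mul]
  exact ⟨setIntegral_nonneg measurableSet_Ioi fun t ht => (h t (le_of_lt ht)).1,
    setIntegral_mono_on (hS.sub hb') hc' measurableSet_Ioi fun t ht => (h t (le_of_lt ht)).2⟩

end HittingTime

/-- Theorem 4.1, refinement of Aldous–Brown: for an irreducible
reversible chain with stationary distribution `pd`, a set `A` whose complement is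
connected for the killed chain, quasi-stationary distribution `a` and
`N = ‖α/π‖₂² = ∑ a(x)²/π(x)`, for all `t ≥ 0`:
`0 ≤ P_π(T_A > t) - N⁻¹ exp(-t/E_α T_A) ≤ ((N-1)/N - π(A)) exp(-t/t_rel)`;
consequently `0 ≤ E_π T_A - N⁻¹ E_α T_A ≤ ((N-1)/N - π(A)) t_rel` and
`0 ≤ E_α T_A - E_π T_A ≤ ((N-1)/N) E_α T_A`. -/
theorem aldous_brown_refinement
    (V : Type) [Fintype V] [DecidableEq V] (K : Matrix V V ℝ) (pd : V → ℝ)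
    (W : CTMC V K)
    (hK0 : ∀ x y : V, 0 ≤ K x y) (hK1 : ∀ x : V, ∑ y : V, K x y = 1)
    (hirr : ∀ x y : V, ∃ k : ℕ, 0 < (K ^ k) x y)
    (hpd : ∀ x, 0 < pd x) (hpd1 : ∑ x : V, pd x = 1)
    (hrev : ∀ x y : V, pd x * K x y = pd y * K y x)
    (A : Finset V) (hA : A.Nonempty) (hAne : A ≠ Finset.univ)
    (hacc : ∀ a b : V, a ∉ A → b ∉ A →
      0 < W.prx a {ω | W.hit {b} ω < W.hit (↑A) ω})
    (a : V → ℝ) (lam : ℝ) (hQSD : IsQSD K A a lam) :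
    let N : ℝ := ∑ x : V, (a x) ^ 2 / pd x
    let Eα : ℝ := W.exw a (W.hit ↑A)
    let Eπ : ℝ := ∑ x : V, pd x * W.ex x (W.hit ↑A)
    let piA : ℝ := ∑ v ∈ A, pd v
    (∀ t : ℝ, 0 ≤ t →
      0 ≤ (∑ x : V, pd x * W.prx x {ω | t < W.hit (↑A) ω}) -
          N⁻¹ * Real.exp (-t / Eα) ∧
      (∑ x : V, pd x * W.prx x {ω | t < W.hit (↑A) ω}) -
          N⁻¹ * Real.exp (-t / Eα) ≤
        ((N - 1) / N - piA) * Real.exp (-t / trel K pd)) ∧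
    (0 ≤ Eπ - N⁻¹ * Eα ∧ Eπ - N⁻¹ * Eα ≤ ((N - 1) / N - piA) * trel K pd) ∧
    (0 ≤ Eα - Eπ ∧ Eα - Eπ ≤ ((N - 1) / N) * Eα) := by
  intro N Eα Eπ piA
  have hrev' : IsRev pd K := hrev
  have hK : IsSubstochastic K := ⟨hK0, fun x => (hK1 x).le⟩
  have : Nontrivial V := by
    obtain ⟨v, hv⟩ := hA
    obtain ⟨w, hw⟩ : ∃ w, w ∉ A := by
      by_contra! h
      exact hAne (Finset.eq_univ_iff_forall.2 h)
    exact ⟨v, w, fun h => hw (h ▸ hv)⟩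
  obtain ⟨hgap, hpoin⟩ := specGap_pos_and_poincare hpd hK0 hK1 hirr hrev'
  have hlam : 0 < lam := hQSD.rate_pos hA hpd hK0 hK1 hirr hrev'
  have hN : N = wInner pd (fun x => a x / pd x) fun x => a x / pd x := by
    rw [wInner_density hpd]
    exact Finset.sum_congr rfl fun x _ => by rw [pow_two, mul_div_assoc]
  have hN0 : 0 < N := by
    rw [hN]
    exact (wInner_self_nonneg hpd _).lt_of_ne' fun h =>
      hQSD.density_ne_zero hpd (wInner_self_eq_zero hpd h)
  have hNdiv : (N - 1) / N = 1 - N⁻¹ := by field_simp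
  set s : V → ℝ → ℝ := fun x t => (heatMat (killedMat K A) t).mulVec (indCompl A) x with hs
  set S : ℝ → ℝ := fun t => ∑ x, pd x * s x t with hS
  have hSw : ∀ t, S t =
      wInner pd (indCompl A) ((heatMat (killedMat K A) t).mulVec (indCompl A)) := fun t =>
    (wInner_indCompl pd
      (heatMat_killedMat_mem_vanishSubmodule K (indCompl_mem_vanishSubmodule A) t)).symm
  have hit := fun x => W.hit_tail_and_ex_of_exp_decay hK A x hlam fun t ht =>
    hQSD.heatMat_killedMat_le W hK hpd hrev' x ht
  have hinteg : ∀ (w : V → ℝ) (x : V), IntegrableOn (fun t => w x * s x t) (Set.Ioi 0) :=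
    fun w x => (hit x).1.const_mul (w x)
  have hex : ∀ w : V → ℝ, ∑ x, w x * W.ex x (W.hit ↑A) =
      ∫ t in Set.Ioi (0 : ℝ), ∑ x, w x * s x t := fun w => by
    rw [integral_finsetSum _ fun x _ => hinteg w x]
    exact Finset.sum_congr rfl fun x _ => by rw [integral_const_mul, (hit x).2.2]
  have hEα : Eα = lam⁻¹ := by
    rw [← integral_exp_neg_mul_Ioi_zero hlam]
    refine (hex a).trans (integral_congr_ae (ae_of_all _ fun t => ?_))
    simp only [hs]
    rw [← wInner_density hpd, hQSD.wInner_density_heatMat hpd hrev',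
      hQSD.wInner_density_indCompl hpd, mul_one]
  have hEπ : Eπ = ∫ t in Set.Ioi (0 : ℝ), S t := hex pd
  have hSint : IntegrableOn S (Set.Ioi 0) := integrable_finsetSum _ fun x _ => hinteg pd x
  have hself : wInner pd (indCompl A) (indCompl A) - N⁻¹ = (N - 1) / N - piA := by
    rw [wInner_indCompl_self hpd1, hNdiv]
    ring
  have hmain : ∀ t, 0 ≤ t → 0 ≤ S t - N⁻¹ * Real.exp (-(lam * t)) ∧
      S t - N⁻¹ * Real.exp (-(lam * t)) ≤
        ((N - 1) / N - piA) * Real.exp (-(specGap K pd * t)) := fun t ht => by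
    rw [hSw, ← hself]
    exact hQSD.wInner_indCompl_heatMat_sub_bounds hpd hrev' hpoin hN ht
  have hEmain := integral_sub_exp_bounds hlam hgap hSint hmain
  have hElam := integral_sub_exp_bounds (m := 0) (M := 1 - piA) hlam hlam hSint fun t ht => by
    rw [zero_mul, sub_zero, hSw, ← wInner_indCompl_self hpd1]
    exact hQSD.wInner_indCompl_heatMat_bounds hpd hrev' ht
  have hpiA : 0 ≤ piA := Finset.sum_nonneg fun v _ => (hpd v).le
  rw [← hEπ, ← hEα] at hEmain hElam
  have hEα0 : 0 < Eα := hEα ▸ inv_pos.2 hlam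
  refine ⟨fun t ht => ?_, hEmain, ?_, ?_⟩
  · have e1 : -t / Eα = -(lam * t) := by rw [hEα, div_inv_eq_mul]; ring
    have e2 : -t / trel K pd = -(specGap K pd * t) := by rw [trel, div_inv_eq_mul]; ring
    have e3 : ∑ x, pd x * W.prx x {ω | t < W.hit (↑A) ω} = S t :=
      Finset.sum_congr rfl fun x _ => by rw [(hit x).2.1 t ht]
    rw [e1, e2, e3]
    exact hmain t ht
  · nlinarith [hElam.2, mul_nonneg hpiA hEα0.le]
  · rw [hNdiv]
    linarith [hEmain.1]
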